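/- Let A : (0,∞) → S₊ be an S₊-valued Bernstein function such that for each nonzero vector v ∈ ℝ^m the function t ↦ vᵀ A(t) v is not identically zero on (0,∞). Then there exist a matrix B ∈ S₊ and an S₊-valued locally integrable completely monotone (LICM) function F such that X(t) = B·δ(t) + F(t) solves (A∗X)(t) = t·I, i.e., A(t)·B + (A∗F)(t) = t·I for all t > 0, where I is the m×m identity matrix; moreover this solution is unique. -/

import Mathlib

open MeasureTheory Set Filter Topology Matrix

noncomputable section

/-- A matrix-valued function `A` on `(0,∞)` is completely monotone (CM): each entry is
infinitely differentiable on `(0,∞)` and for every `v : ℝ^m` and `n : ℕ`,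
`(-1)^n (d/dt)^n (vᵀ A(t) v) ≥ 0` for `t > 0`. -/
def MatCM (m : ℕ) (A : ℝ → Matrix (Fin m) (Fin m) ℝ) : Prop :=
  (∀ i j, ContDiffOn ℝ (⊤ : ℕ∞) (fun t => A t i j) (Set.Ioi 0)) ∧
  ∀ v : Fin m → ℝ, ∀ n : ℕ, ∀ t ∈ Set.Ioi (0:ℝ),
    0 ≤ (-1 : ℝ) ^ n * iteratedDeriv n (fun s => v ⬝ᵥ (A s).mulVec v) t

/-- Locally integrable completely monotone (LICM): CM and integrable over `(0,1]`. -/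
def MatLICM (m : ℕ) (A : ℝ → Matrix (Fin m) (Fin m) ℝ) : Prop :=
  MatCM m A ∧ ∀ i j, MeasureTheory.IntegrableOn (fun t => A t i j) (Set.Ioc 0 1)

/-- Entrywise derivative of a matrix-valued function. -/
def matDeriv (m : ℕ) (A : ℝ → Matrix (Fin m) (Fin m) ℝ) : ℝ → Matrix (Fin m) (Fin m) ℝ :=
  fun t => Matrix.of fun i j => deriv (fun s => A s i j) t

/-- A matrix-valued Bernstein function: differentiable on `(0,∞)` with CM derivative. -/
def MatBernstein (m : ℕ) (A : ℝ → Matrix (Fin m) (Fin m) ℝ) : Prop :=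
  (∀ i j, DifferentiableOn ℝ (fun t => A t i j) (Set.Ioi 0)) ∧ MatCM m (matDeriv m A)

/-- The Laplace transform `Ã(p) = ∫₀^∞ e^{-pt} A(t) dt` (entrywise). -/
def matLaplace (m : ℕ) (A : ℝ → Matrix (Fin m) (Fin m) ℝ) (p : ℝ) :
    Matrix (Fin m) (Fin m) ℝ :=
  Matrix.of fun i j => ∫ t in Set.Ioi (0:ℝ), Real.exp (-p * t) * A t i j

/-- Convolution of matrix-valued functions: `(A∗B)(t) = ∫₀ᵗ A(s) B(t-s) ds`. -/
def matConv (m : ℕ) (A B : ℝ → Matrix (Fin m) (Fin m) ℝ) (t : ℝ) :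
    Matrix (Fin m) (Fin m) ℝ :=
  Matrix.of fun i j => ∫ s in (0:ℝ)..t, ∑ k, A s i k * B (t - s) k j

/-- Convolution of a matrix-valued function with a vector-valued function:
`(A∗v)(t) = ∫₀ᵗ A(s) v(t-s) ds`. -/
def matVecConv (m : ℕ) (A : ℝ → Matrix (Fin m) (Fin m) ℝ) (v : ℝ → Fin m → ℝ) (t : ℝ) :
    Fin m → ℝ :=
  fun i => ∫ s in (0:ℝ)..t, ∑ k, A s i k * v (t - s) k

/-- The decrement `n ↦ f n - f (n + p)` of a sequence. -/
def stepDiff {E : Type*} [AddCommGroup E] (p : ℕ) (f : ℕ → E) : ℕ → E := fun n => f n - f (n + p)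

/-- A real sequence is completely monotone if all its iterated decrements are nonnegative. -/
def SeqCM (f : ℕ → ℝ) : Prop := ∀ k n, 0 ≤ (stepDiff 1)^[k] f n

/-- The quadratic form `M ↦ vᵀ M v`, as a linear map in the matrix. -/
def quadForm {n : Type*} [Fintype n] (v : n → ℝ) : Matrix n n ℝ →ₗ[ℝ] ℝ where
  toFun M := v ⬝ᵥ M *ᵥ v
  map_add' M N := by simp [Matrix.add_mulVec, dotProduct_add]
  map_smul' c M := by simp [Matrix.smul_mulVec, dotProduct_smul]

lemma quadForm_apply {n : Type*} [Fintype n] (v : n → ℝ) (M : Matrix n n ℝ) :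
    quadForm v M = v ⬝ᵥ M *ᵥ v := rfl

lemma posSemidef_iff_quadForm {n : Type*} [Fintype n] {M : Matrix n n ℝ} :
    M.PosSemidef ↔ Mᵀ = M ∧ ∀ v, 0 ≤ quadForm v M := by
  rw [posSemidef_iff_dotProduct_mulVec]
  simp [IsHermitian, quadForm_apply, conjTranspose_eq_transpose_of_trivial]

lemma map_stepDiff_iterate {E E' : Type*} [AddCommGroup E] [AddCommGroup E'] (L : E →+ E')
    (p k : ℕ) (f : ℕ → E) (n : ℕ) :
    (stepDiff p)^[k] (fun i => L (f i)) n = L ((stepDiff p)^[k] f n) := by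
  induction k generalizing f n with
  | zero => rfl
  | succ k ih =>
    simp only [Function.iterate_succ, Function.comp_apply]
    rw [← ih]
    have e : stepDiff p (fun i => L (f i)) = fun i => L (stepDiff p f i) := by
      funext i
      simp [stepDiff]
    rw [e]

lemma quadForm_stepDiff_iterate {n : Type*} [Fintype n] (v : n → ℝ) (k : ℕ)
    (f : ℕ → Matrix n n ℝ) (i : ℕ) :
    quadForm v ((stepDiff 1)^[k] f i) = (stepDiff 1)^[k] (fun j => quadForm v (f j)) i :=
  (map_stepDiff_iterate (quadForm v).toAddMonoidHom 1 k f i).symm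

lemma posSemidef_pow_mul_pow {d : Type*} [Fintype d] [DecidableEq d] {Z : Matrix d d ℝ}
    (h0 : Z.PosSemidef) (h1 : (1 - Z).PosSemidef) (n k : ℕ) :
    (Z ^ n * (1 - Z) ^ k).PosSemidef := by
  have hZ : Zᴴ = Z := h0.1
  have hW : (1 - Z)ᴴ = 1 - Z := h1.1
  have hc : Commute Z (1 - Z) := (Commute.one_right Z).sub_right (Commute.refl Z)
  induction n using Nat.strong_induction_on generalizing k with
  | _ n ihn =>
  match n, ihn with
  | n + 2, ihn =>
    have h := (ihn n (by omega) k).conjTranspose_mul_mul_same Z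
    have e : Z ^ (n + 2) * (1 - Z) ^ k = Z * (Z ^ n * (1 - Z) ^ k) * Z := by
      rw [pow_succ', pow_succ, mul_assoc, mul_assoc, mul_assoc, mul_assoc, (hc.pow_right k).eq]
    rwa [e, ← congrArg (· * (Z ^ n * (1 - Z) ^ k) * Z) hZ]
  | 0, _ =>
    rw [pow_zero, one_mul]
    exact h1.pow k
  | 1, _ =>
    rw [pow_one]
    induction k using Nat.strong_induction_on with
    | _ k ihk =>
    match k, ihk with
    | 0, _ => simpa using h0
    | 1, _ =>
      have e : Z * (1 - Z) ^ 1 = Z * (1 - Z) * Z + (1 - Z) * Z * (1 - Z) := by noncomm_ring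
      have a := h1.conjTranspose_mul_mul_same Z
      have b := h0.conjTranspose_mul_mul_same (1 - Z)
      rw [hZ] at a
      rw [hW] at b
      rw [e]
      exact a.add b
    | k + 2, ihk =>
      have h := (ihk k (by omega)).conjTranspose_mul_mul_same (1 - Z)
      have e : Z * (1 - Z) ^ (k + 2) = (1 - Z) * (Z * (1 - Z) ^ k) * (1 - Z) := by
        rw [pow_succ', pow_succ, ← mul_assoc, ← mul_assoc, hc.eq]
        simp only [mul_assoc]
      rwa [e, ← congrArg (· * (Z * (1 - Z) ^ k) * (1 - Z)) hW]

lemma stepDiff_iterate_conj_pow {d n : Type*} [Fintype d] [DecidableEq d]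
    (Z : Matrix d d ℝ) (U : Matrix d n ℝ) (k i : ℕ) :
    (stepDiff 1)^[k] (fun j => Uᵀ * Z ^ j * U) i = Uᵀ * (Z ^ i * (1 - Z) ^ k) * U := by
  induction k generalizing i with
  | zero => simp
  | succ k ih =>
    rw [Function.iterate_succ_apply', stepDiff, ih, ih]
    simp only [Matrix.mul_assoc, ← Matrix.mul_sub, ← Matrix.sub_mul]
    congr 1
    rw [pow_succ' (1 - Z), pow_succ]
    simp only [Matrix.sub_mul, Matrix.mul_sub, Matrix.mul_assoc, Matrix.one_mul]

/-- The convolution inverse (times the constant sequence `1`) of a matrix moment sequence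
`Kᵀ diag(x)ⁿ K` with nodes in `[0, 1]`, in closed form. -/
lemma exists_conv_inverse_of_moments {d n : Type*} [Fintype d] [DecidableEq d] [Fintype n]
    [DecidableEq n] (K : Matrix d n ℝ) (x : d → ℝ) (hx0 : ∀ i, 0 ≤ x i) (hx1 : ∀ i, x i ≤ 1)
    (hdet : IsUnit (Kᵀ * K).det) :
    ∃ X : ℕ → Matrix n n ℝ,
      (∀ N, ∑ k ∈ Finset.range (N + 1), Kᵀ * diagonal x ^ (N - k) * K * X k = 1) ∧
      (∀ N, (X N).PosSemidef) ∧ ∀ v, SeqCM fun N => quadForm v (X (N + 1)) := by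
  set a := Kᵀ * K with ha
  set V : Matrix d d ℝ := diagonal fun i => √(1 - x i) with hV
  set y := K * a⁻¹ with hy
  set P := K * a⁻¹ * Kᵀ with hP
  set Q := 1 - P with hQ
  set Z := 1 - V * Q * V with hZ
  have haT : aᵀ = a := by simp [ha]
  have haiT : (a⁻¹)ᵀ = a⁻¹ := by rw [transpose_nonsing_inv, haT]
  have hVV : V * V = 1 - diagonal x := by
    rw [hV, diagonal_mul_diagonal, ← diagonal_one, diagonal_sub]
    congr 1
    funext i
    exact Real.mul_self_sqrt (by linarith [hx1 i])
  have hVT : Vᵀ = V := by simp [hV]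
  have hPT : Pᵀ = P := by simp [hP, haiT, Matrix.mul_assoc]
  have hPP : P * P = P := by
    calc P * P = K * (a⁻¹ * (Kᵀ * K) * a⁻¹) * Kᵀ := by simp only [hP, Matrix.mul_assoc]
      _ = P := by rw [← ha, nonsing_inv_mul _ hdet, Matrix.one_mul]
  have hQT : Qᵀ = Q := by simp [hQ, hPT]
  have hQQ : Q * Q = Q := by simp [hQ, Matrix.mul_sub, Matrix.sub_mul, hPP]
  have hKQ : Kᵀ * Q = 0 := by
    rw [hQ, Matrix.mul_sub, Matrix.mul_one, hP, ← Matrix.mul_assoc, ← Matrix.mul_assoc, ← ha,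
      mul_nonsing_inv _ hdet, Matrix.one_mul, sub_self]
  have hVQV : (V * Q * V).PosSemidef := by
    have := posSemidef_conjTranspose_mul_self (Q * V)
    rw [conjTranspose_eq_transpose_of_trivial, transpose_mul, hVT, hQT] at this
    have e : V * Q * (Q * V) = V * Q * V := by
      rw [← Matrix.mul_assoc, Matrix.mul_assoc V Q Q, hQQ]
    rwa [e] at this
  have hPpsd : P.PosSemidef := by
    have := posSemidef_conjTranspose_mul_self P
    rwa [conjTranspose_eq_transpose_of_trivial, hPT, hPP] at this
  have hZ1 : (1 - Z).PosSemidef := by rwa [hZ, sub_sub_cancel]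
  have hZ0 : Z.PosSemidef := by
    have e : Z = diagonal x + Vᴴ * P * V := by
      rw [conjTranspose_eq_transpose_of_trivial, hVT, hZ, hQ, Matrix.mul_sub, Matrix.sub_mul,
        Matrix.mul_one, hVV]
      abel
    rw [e]
    exact (PosSemidef.diagonal hx0).add (hPpsd.conjTranspose_mul_mul_same V)
  let X : ℕ → Matrix n n ℝ := fun N => Nat.casesOn N a⁻¹ fun N => (V * y)ᵀ * Z ^ N * (V * y)
  have hKT : Kᵀ * y = 1 := by rw [hy, ← Matrix.mul_assoc, ← ha, mul_nonsing_inv _ hdet]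
  have key : ∀ N, ∃ z : Matrix d n ℝ,
      z = ∑ k ∈ Finset.range (N + 1), diagonal x ^ (N - k) * K * X k ∧
      Kᵀ * z = 1 ∧ V * z = Z ^ N * (V * y) := by
    intro N
    induction N with
    | zero => exact ⟨y, by simp [X, hy], hKT, by simp⟩
    | succ N ih =>
      obtain ⟨z, hz, hz1, hz2⟩ := ih
      refine ⟨z - Q * (V * (V * z)), ?_, ?_, ?_⟩
      · rw [Finset.sum_range_succ, Nat.sub_self, pow_zero, Matrix.one_mul]
        have e1 : ∑ k ∈ Finset.range (N + 1), diagonal x ^ (N + 1 - k) * K * X k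
            = diagonal x * z := by
          rw [hz, Matrix.mul_sum]
          refine Finset.sum_congr rfl fun k hk => ?_
          rw [Nat.succ_sub (by simpa [Nat.lt_succ_iff] using hk), pow_succ']
          simp only [Matrix.mul_assoc]
        have e2 : K * X (N + 1) = P * (V * (V * z)) := by
          rw [hz2]
          simp only [X, transpose_mul, hVT, hy, haiT, hP, Matrix.mul_assoc]
        have e3 : diagonal x * z = z - V * (V * z) := by
          rw [← Matrix.mul_assoc, hVV, Matrix.sub_mul, Matrix.one_mul, sub_sub_cancel]
        rw [e1, e2, e3, hQ, Matrix.sub_mul, Matrix.one_mul]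
        abel
      · rw [Matrix.mul_sub, ← Matrix.mul_assoc, hKQ, Matrix.zero_mul, sub_zero, hz1]
      · rw [Matrix.mul_sub, hz2, pow_succ', hZ]
        simp only [Matrix.sub_mul, Matrix.one_mul, Matrix.mul_assoc]
  refine ⟨X, fun N => ?_, fun N => ?_, fun v k N => ?_⟩
  · obtain ⟨z, hz, hz1, -⟩ := key N
    rw [hz, Matrix.mul_sum] at hz1
    simpa only [Matrix.mul_assoc] using hz1
  · cases N with
    | zero =>
      have := posSemidef_conjTranspose_mul_self y
      have e : yᴴ * y = a⁻¹ := by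
        rw [conjTranspose_eq_transpose_of_trivial, hy, transpose_mul, haiT, Matrix.mul_assoc,
          ← Matrix.mul_assoc Kᵀ, ← ha, mul_nonsing_inv _ hdet, Matrix.mul_one]
      rwa [e] at this
    | succ N => exact (hZ0.pow N).conjTranspose_mul_mul_same (V * y)
  · rw [← quadForm_stepDiff_iterate]
    have := stepDiff_iterate_conj_pow Z (V * y) k N
    change quadForm v ((stepDiff 1)^[k] (fun N => (V * y)ᵀ * Z ^ N * (V * y)) N) ≥ 0
    rw [this]
    exact (posSemidef_iff_quadForm.1
      ((posSemidef_pow_mul_pow hZ0 hZ1 N k).conjTranspose_mul_mul_same (V * y))).2 v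

lemma PosSemidef.exists_eq_transpose_mul_self {n : Type*} [Fintype n] [DecidableEq n]
    {M : Matrix n n ℝ} (h : M.PosSemidef) : ∃ C : Matrix n n ℝ, M = Cᵀ * C := by
  open scoped MatrixOrder in
  obtain ⟨C, hC⟩ := CStarAlgebra.nonneg_iff_eq_star_mul_self.mp h.nonneg
  exact ⟨C, by rw [hC, star_eq_conjTranspose, conjTranspose_eq_transpose_of_trivial]⟩

lemma PosSemidef.abs_apply_le_trace {n : Type*} [Fintype n] [DecidableEq n]
    {M : Matrix n n ℝ} (h : M.PosSemidef) (i j : n) : |M i j| ≤ M.trace := by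
  obtain ⟨C, rfl⟩ := PosSemidef.exists_eq_transpose_mul_self h
  have hle : ∀ i, ∑ k, C k i ^ 2 ≤ (Cᵀ * C).trace := fun i => by
    have : ∀ i, (Cᵀ * C) i i = ∑ k, C k i ^ 2 := fun i => by simp [mul_apply, sq]
    simp only [trace, diag_apply, this]
    exact Finset.single_le_sum (f := fun i => ∑ k, C k i ^ 2)
      (fun i _ => Finset.sum_nonneg fun k _ => sq_nonneg _) (Finset.mem_univ i)
  have h1 := hle i
  have h2 := hle j
  have h3 : |∑ k, C k i * C k j| ≤ ∑ k, (C k i ^ 2 + C k j ^ 2) / 2 := by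
    refine (Finset.abs_sum_le_sum_abs _ _).trans (Finset.sum_le_sum fun k _ => ?_)
    rw [abs_le]
    constructor <;> nlinarith [sq_nonneg (C k i + C k j), sq_nonneg (C k i - C k j)]
  rw [← Finset.sum_div, Finset.sum_add_distrib] at h3
  have e : (Cᵀ * C) i j = ∑ k, C k i * C k j := by simp [mul_apply]
  rw [e]
  linarith

lemma tendsto_matrix {ι n n' : Type*} {l : Filter ι} {M : ι → Matrix n n' ℝ} {M₀ : Matrix n n' ℝ}
    (h : ∀ i j, Tendsto (fun N => M N i j) l (𝓝 (M₀ i j))) : Tendsto M l (𝓝 M₀) :=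
  tendsto_pi_nhds.2 fun i => tendsto_pi_nhds.2 (h i)

lemma Filter.Tendsto.matrix_apply {ι n n' : Type*} {l : Filter ι} {M : ι → Matrix n n' ℝ}
    {M₀ : Matrix n n' ℝ} (h : Tendsto M l (𝓝 M₀)) (i : n) (j : n') :
    Tendsto (fun N => M N i j) l (𝓝 (M₀ i j)) :=
  tendsto_pi_nhds.1 (tendsto_pi_nhds.1 h i) j

lemma exists_choose_ratio_bound (i : ℕ) : ∃ ε : ℕ → ℝ, Tendsto ε atTop (𝓝 0) ∧
    ∀ N > i, ∀ j ≤ N, |(j.choose i : ℝ) / N.choose i - (j / N : ℝ) ^ i| ≤ ε N := by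
  induction i with
  | zero => exact ⟨fun _ => 0, tendsto_const_nhds, fun N _ j _ => by simp⟩
  | succ i ih =>
    obtain ⟨ε, hε, hb⟩ := ih
    refine ⟨fun N => i / ((N : ℝ) - i) + ε N, ?_, fun N hN j hj => ?_⟩
    · have : Tendsto (fun N : ℕ => (i : ℝ) / ((N : ℝ) - i)) atTop (𝓝 0) :=
        Tendsto.const_div_atTop
          (tendsto_atTop_add_const_right _ _ tendsto_natCast_atTop_atTop) _
      simpa using this.add hε
    · have h := hb N (by omega) j hj
      have hNi : (0 : ℝ) < (N : ℝ) - i := by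
        have : (i : ℝ) + 1 < N := by exact_mod_cast hN
        linarith
      have hN0 : (0 : ℝ) < N := by
        have : 0 < N := by omega
        exact_mod_cast this
      have hjN : (j : ℝ) ≤ N := by exact_mod_cast hj
      have hx0 : (0 : ℝ) ≤ j / N := by positivity
      have hx1 : (j / N : ℝ) ≤ 1 := (div_le_one hN0).2 hjN
      have hρ0 : (0 : ℝ) ≤ (j.choose i : ℝ) / N.choose i := by positivity
      have hρ1 : (j.choose i : ℝ) / N.choose i ≤ 1 := by
        apply div_le_one_of_le₀ _ (by positivity)
        exact_mod_cast Nat.choose_le_choose i hj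
      have hrec : (j.choose (i + 1) : ℝ) / N.choose (i + 1)
          = (j.choose i : ℝ) / N.choose i * ((j - i : ℕ) / ((N : ℝ) - i)) := by
        have a1 : (j.choose (i + 1) : ℝ) * (i + 1) = j.choose i * (j - i : ℕ) := by
          exact_mod_cast Nat.choose_succ_right_eq j i
        have a2 : (N.choose (i + 1) : ℝ) * (i + 1) = N.choose i * ((N : ℝ) - i) := by
          rw [← Nat.cast_sub (by omega)]
          exact_mod_cast Nat.choose_succ_right_eq N i
        have p1 : (0 : ℝ) < N.choose (i + 1) := by exact_mod_cast Nat.choose_pos (by omega)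
        have p2 : (0 : ℝ) < N.choose i := by exact_mod_cast Nat.choose_pos (by omega)
        rw [← mul_div_mul_right _ _ (by positivity : (i : ℝ) + 1 ≠ 0), a1, a2]
        field_simp
      have hstep : (j.choose i : ℝ) / N.choose i * |(j - i : ℕ) / ((N : ℝ) - i) - j / N|
          ≤ i / ((N : ℝ) - i) := by
        rcases lt_or_ge j i with hji | hji
        · rw [Nat.choose_eq_zero_of_lt hji]
          simp only [Nat.cast_zero, zero_div, zero_mul]
          positivity
        · refine (mul_le_of_le_one_left (abs_nonneg _) hρ1).trans ?_
          rw [Nat.cast_sub hji]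
          have e : ((j : ℝ) - i) / ((N : ℝ) - i) - j / N
              = -(i / ((N : ℝ) - i) * (1 - j / N)) := by
            field_simp
            ring
          rw [e, abs_neg, abs_of_nonneg (mul_nonneg (by positivity) (by linarith))]
          exact mul_le_of_le_one_right (by positivity) (by linarith)
      calc |(j.choose (i + 1) : ℝ) / N.choose (i + 1) - (j / N : ℝ) ^ (i + 1)|
          = |(j.choose i : ℝ) / N.choose i * ((j - i : ℕ) / ((N : ℝ) - i) - j / N)
            + (j / N) * ((j.choose i : ℝ) / N.choose i - (j / N : ℝ) ^ i)| := by
            rw [hrec]; congr 1; ring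
        _ ≤ _ := by
            refine (abs_add_le _ _).trans (add_le_add ?_ ?_)
            · rw [abs_mul, abs_of_nonneg hρ0]
              exact hstep
            · rw [abs_mul, abs_of_nonneg hx0]
              exact (mul_le_of_le_one_left (abs_nonneg _) hx1).trans h

lemma eq_sum_choose_smul_stepDiff {E : Type*} [AddCommGroup E] (M : ℕ) (f : ℕ → E) (n : ℕ) :
    f n = ∑ i ∈ Finset.range (M + 1), M.choose i • (stepDiff 1)^[M - i] f (n + i) := by
  let S : Module.End ℤ (ℕ → E) := { toFun := fun f i => f (i + 1), map_add' := fun _ _ => rfl,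
                                    map_smul' := fun _ _ => rfl }
  let D : Module.End ℤ (ℕ → E) :=
    { toFun := stepDiff 1
      map_add' := fun f g => by funext i; simp [stepDiff]; abel
      map_smul' := fun c f => by funext i; simp [stepDiff, smul_sub] }
  have hSD : S + D = 1 := by
    ext f i
    simp [S, D, stepDiff]
  have hc : Commute S D := by
    have : D = 1 - S := by rw [← hSD]; abel
    rw [this]
    exact (Commute.one_right S).sub_right (Commute.refl S)
  have hS : ∀ k (g : ℕ → E) i, (S ^ k) g i = g (i + k) := by
    intro k
    induction k with
    | zero => intro g i; rfl
    | succ k ih =>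
      intro g i
      rw [pow_succ, Module.End.mul_apply, ih]
      simp [S, add_assoc]
  have hD : ∀ k (g : ℕ → E), (D ^ k) g = (stepDiff 1)^[k] g := fun k g => by
    rw [Module.End.pow_apply]; rfl
  have h := hc.add_pow M
  rw [hSD, one_pow] at h
  have h2 := congrFun (LinearMap.congr_fun h f) n
  rw [Module.End.one_apply] at h2
  rw [h2, LinearMap.sum_apply, Finset.sum_apply]
  refine Finset.sum_congr rfl fun i _ => ?_
  rw [← nsmul_eq_mul', LinearMap.smul_apply, Module.End.mul_apply, Pi.smul_apply, hS, hD]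

lemma eq_sum_choose_ratio_smul {E : Type*} [AddCommGroup E] [Module ℝ E] (f : ℕ → E) {i N : ℕ}
    (hi : i ≤ N) :
    f i = ∑ j ∈ Finset.range (N + 1),
      ((j.choose i : ℝ) / N.choose i) • N.choose j • (stepDiff 1)^[N - j] f j := by
  rw [eq_sum_choose_smul_stepDiff (N - i) f i]
  have : N + 1 = i + (N - i + 1) := by omega
  rw [this, Finset.sum_range_add _ i, Finset.sum_eq_zero (s := Finset.range i), zero_add]
  · refine Finset.sum_congr rfl fun k hk => ?_
    have hk : k ≤ N - i := by simpa [Nat.lt_succ_iff] using hk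
    have h := Nat.choose_mul (n := N) (k := i + k) (s := i) (by omega)
    rw [Nat.add_sub_cancel_left] at h
    have h' : (N.choose (i + k) : ℝ) * (i + k).choose i = N.choose i * (N - i).choose k := by
      exact_mod_cast h
    have p : (0 : ℝ) < N.choose i := by exact_mod_cast Nat.choose_pos hi
    rw [← Nat.cast_smul_eq_nsmul ℝ, ← Nat.cast_smul_eq_nsmul ℝ, smul_smul, Nat.sub_sub]
    congr 1
    field_simp
    linarith
  · intro j hj
    rw [Nat.choose_eq_zero_of_lt (by simpa using hj)]
    simp

/-- A completely monotone sequence of matrices is a limit of finite moment sequences with nodes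
in `[0, 1]` and the same zeroth moment. -/
lemma exists_moment_approx {n : Type*} [Fintype n] [DecidableEq n] (a : ℕ → Matrix n n ℝ)
    (hsym : ∀ i, (a i)ᵀ = a i) (hcm : ∀ v, SeqCM fun i => quadForm v (a i)) :
    ∃ (K : ∀ N : ℕ, Matrix (Fin (N + 1) × n) n ℝ) (x : ∀ N : ℕ, Fin (N + 1) × n → ℝ),
      (∀ N p, 0 ≤ x N p ∧ x N p ≤ 1) ∧ (∀ N, (K N)ᵀ * K N = a 0) ∧
      ∀ i, Tendsto (fun N => (K N)ᵀ * diagonal (x N) ^ i * K N) atTop (𝓝 (a i)) := by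
  let w : ℕ → ℕ → Matrix n n ℝ := fun N j => N.choose j • (stepDiff 1)^[N - j] a j
  have hD : ∀ k j, ((stepDiff 1)^[k] a j).PosSemidef := fun k j => by
    refine posSemidef_iff_quadForm.2 ⟨?_, fun v => ?_⟩
    · have := map_stepDiff_iterate (transposeAddEquiv n n ℝ).toAddMonoidHom 1 k a j
      simp only [AddEquiv.toAddMonoidHom_eq_coe, AddMonoidHom.coe_coe, transposeAddEquiv_apply,
        hsym] at this
      exact this.symm
    · rw [quadForm_stepDiff_iterate]
      exact hcm v k j
  have hw : ∀ N j, (w N j).PosSemidef := fun N j => by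
    simp only [w, ← Nat.cast_smul_eq_nsmul ℝ]
    exact (hD _ _).smul (by positivity)
  choose C hC using fun N j => PosSemidef.exists_eq_transpose_mul_self (hw N j)
  have hmom : ∀ (N i : ℕ), (of fun (p : Fin (N + 1) × n) c => C N p.1 p.2 c)ᵀ *
      diagonal (fun p : Fin (N + 1) × n => ((p.1 : ℕ) / N : ℝ)) ^ i *
      (of fun (p : Fin (N + 1) × n) c => C N p.1 p.2 c)
      = ∑ j ∈ Finset.range (N + 1), (j / N : ℝ) ^ i • w N j := by
    intro N i
    rw [Finset.sum_range]
    ext r s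
    rw [diagonal_pow, Matrix.mul_apply, Fintype.sum_prod_type, Matrix.sum_apply]
    refine Finset.sum_congr rfl fun j _ => ?_
    rw [Matrix.smul_apply, hC, Matrix.mul_apply, smul_eq_mul, Finset.mul_sum]
    refine Finset.sum_congr rfl fun k _ => ?_
    rw [mul_diagonal]
    simp only [transpose_apply, of_apply, Pi.pow_apply]
    ring
  have hsum : ∀ N, ∑ j ∈ Finset.range (N + 1), w N j = a 0 := fun N => by
    rw [eq_sum_choose_ratio_smul a (Nat.zero_le N)]
    simp [w]
  refine ⟨fun N => of fun p c => C N p.1 p.2 c, fun N p => (p.1 : ℕ) / N, fun N p => ⟨?_, ?_⟩,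
    fun N => ?_, fun i => ?_⟩
  · positivity
  · apply div_le_one_of_le₀ _ (by positivity)
    exact_mod_cast Nat.lt_succ_iff.1 p.1.2
  · have := hmom N 0
    rw [pow_zero, Matrix.mul_one] at this
    simpa [hsum] using this
  · obtain ⟨ε, hε, hb⟩ := exists_choose_ratio_bound i
    refine tendsto_matrix fun r s => ?_
    rw [tendsto_iff_norm_sub_tendsto_zero]
    have hlim : Tendsto (fun N => ε N * (a 0).trace) atTop (𝓝 0) := by
      simpa using hε.mul_const (a 0).trace
    refine squeeze_zero' (Eventually.of_forall fun N => norm_nonneg _) ?_ hlim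
    filter_upwards [eventually_gt_atTop i] with N hN
    rw [hmom, eq_sum_choose_ratio_smul a hN.le, ← Matrix.sub_apply,
      ← Finset.sum_sub_distrib, Matrix.sum_apply,
      Real.norm_eq_abs, ← hsum N, trace_sum, Finset.mul_sum]
    refine (Finset.abs_sum_le_sum_abs _ _).trans (Finset.sum_le_sum fun j hj => ?_)
    change |(((j / N : ℝ) ^ i • w N j) - ((j.choose i : ℝ) / N.choose i) • w N j) r s| ≤ _
    rw [← sub_smul, Matrix.smul_apply, smul_eq_mul, abs_mul, abs_sub_comm]
    exact mul_le_mul (hb N hN j (by simpa [Nat.lt_succ_iff] using hj))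
      (PosSemidef.abs_apply_le_trace (hw N j) r s) (abs_nonneg _)
      ((abs_nonneg _).trans (hb N hN 0 (Nat.zero_le N)))

/-- The solution `X` of `∑ₖ a (N - k) * X k = 1` for all `N`. -/
def invSeq {n : Type*} [Fintype n] [DecidableEq n] (a : ℕ → Matrix n n ℝ) : ℕ → Matrix n n ℝ
  | N => (a 0)⁻¹ * (1 - ∑ k : Fin N, a (N - k) * invSeq a k)

lemma invSeq_eq_of_conv_eq_one {n : Type*} [Fintype n] [DecidableEq n] {a X : ℕ → Matrix n n ℝ}
    (hdet : IsUnit (a 0).det) :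
    (∀ N, ∑ k ∈ Finset.range (N + 1), a (N - k) * X k = 1) ↔ X = invSeq a := by
  have hstep : ∀ N, (∑ k ∈ Finset.range (N + 1), a (N - k) * X k = 1 ↔
      X N = (a 0)⁻¹ * (1 - ∑ k : Fin N, a (N - k) * X k)) := fun N => by
    rw [Finset.sum_range_succ, Nat.sub_self, Finset.sum_range]
    constructor
    · intro h
      rw [← h, add_sub_cancel_left, ← Matrix.mul_assoc, nonsing_inv_mul _ hdet, Matrix.one_mul]
    · intro h
      rw [h, ← Matrix.mul_assoc, mul_nonsing_inv _ hdet, Matrix.one_mul, add_sub_cancel]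
  constructor
  · intro h
    funext N
    induction N using Nat.strong_induction_on with
    | _ N ih =>
      rw [(hstep N).1 (h N), invSeq]
      simp only [ih _ (Fin.is_lt _)]
  · rintro rfl N
    rw [hstep, invSeq]

lemma tendsto_invSeq {n ι : Type*} [Fintype n] [DecidableEq n] {l : Filter ι}
    {a : ι → ℕ → Matrix n n ℝ} {b : ℕ → Matrix n n ℝ} (h0 : ∀ N, a N 0 = b 0)
    (h : ∀ i, Tendsto (fun N => a N i) l (𝓝 (b i))) (i : ℕ) :
    Tendsto (fun N => invSeq (a N) i) l (𝓝 (invSeq b i)) := by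
  induction i using Nat.strong_induction_on with
  | _ i ih =>
    have e : (fun N => invSeq (a N) i)
        = fun N => (b 0)⁻¹ * (1 - ∑ k : Fin i, a N (i - k) * invSeq (a N) k) := by
      funext N
      rw [invSeq, h0]
    rw [e, invSeq]
    exact tendsto_const_nhds.mul (tendsto_const_nhds.sub
      (tendsto_finsetSum _ fun k _ => (h _).mul (ih k k.2)))

lemma continuous_quadForm {n : Type*} [Fintype n] (v : n → ℝ) : Continuous (quadForm v) := by
  have : (quadForm v : Matrix n n ℝ → ℝ) = fun M => v ⬝ᵥ M *ᵥ v := rfl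
  rw [this]
  fun_prop

lemma tendsto_stepDiff_iterate {ι : Type*} {l : Filter ι} {f : ι → ℕ → ℝ} {g : ℕ → ℝ}
    (h : ∀ i, Tendsto (fun N => f N i) l (𝓝 (g i))) (p k i : ℕ) :
    Tendsto (fun N => (stepDiff p)^[k] (f N) i) l (𝓝 ((stepDiff p)^[k] g i)) := by
  induction k generalizing f g i with
  | zero => exact h i
  | succ k ih =>
    simp only [Function.iterate_succ, Function.comp_apply]
    exact ih (fun i => (h i).sub (h (i + p))) i

lemma isClosed_posSemidef {n : Type*} [Fintype n] :
    IsClosed {M : Matrix n n ℝ | M.PosSemidef} := by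
  simp only [posSemidef_iff_quadForm, ofPred_and, ofPred_forall]
  exact (isClosed_eq (by fun_prop) continuous_id).inter
    (isClosed_iInter fun v => isClosed_le continuous_const (continuous_quadForm v))

/-- The convolution inverse (times the constant sequence `1`) of a completely monotone sequence of
matrices is, from index one on, completely monotone. -/
lemma exists_conv_inverse_of_seqCM {n : Type*} [Fintype n] [DecidableEq n] (a : ℕ → Matrix n n ℝ)
    (hsym : ∀ i, (a i)ᵀ = a i) (hdet : IsUnit (a 0).det)
    (hcm : ∀ v, SeqCM fun i => quadForm v (a i)) :
    ∃ X : ℕ → Matrix n n ℝ,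
      (∀ N, ∑ k ∈ Finset.range (N + 1), a (N - k) * X k = 1) ∧
      (∀ N, (X N).PosSemidef) ∧ ∀ v, SeqCM fun N => quadForm v (X (N + 1)) := by
  obtain ⟨K, x, hx, hK0, hlim⟩ := exists_moment_approx a hsym hcm
  have hX := fun N => exists_conv_inverse_of_moments (K N) (x N) (fun i => (hx N i).1)
    (fun i => (hx N i).2) (by rwa [hK0])
  let b : ℕ → ℕ → Matrix n n ℝ := fun N i => (K N)ᵀ * diagonal (x N) ^ i * K N
  have hb0 : ∀ N, b N 0 = a 0 := fun N => by simp [b, hK0]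
  choose X h1 h2 h3 using hX
  have hXeq : ∀ N, X N = invSeq (b N) := fun N =>
    (invSeq_eq_of_conv_eq_one (a := b N) (by rwa [hb0])).1 (h1 N)
  have ht := fun i => tendsto_invSeq (a := b) hb0 hlim i
  simp only [← hXeq] at ht
  refine ⟨invSeq a, (invSeq_eq_of_conv_eq_one hdet).2 rfl, fun N => ?_, fun v k i => ?_⟩
  · exact isClosed_posSemidef.mem_of_tendsto (ht N) (Eventually.of_forall fun M => h2 M N)
  · exact ge_of_tendsto' (tendsto_stepDiff_iterate
      (fun i => ((continuous_quadForm v).tendsto _).comp (ht (i + 1))) 1 k i)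
      fun N => h3 N v k i

/-- The decrement of a function of a real variable over a step of length `s`. -/
def decr (s : ℝ) (f : ℝ → ℝ) : ℝ → ℝ := fun t => f t - f (t + s)

/-- Complete monotonicity on `(0,∞)` expressed by finite differences of arbitrary steps, without
any regularity assumption. -/
def DiffCM (f : ℝ → ℝ) : Prop :=
  ∀ l : List ℝ, (∀ s ∈ l, 0 < s) → ∀ t, 0 < t → 0 ≤ l.foldr decr f t

lemma tendsto_foldr_decr {ι : Type*} {u : Filter ι} {f : ι → ℝ → ℝ} {g : ℝ → ℝ}
    (h : ∀ t, 0 < t → Tendsto (fun i => f i t) u (𝓝 (g t))) (l : List ℝ) (hl : ∀ s ∈ l, 0 < s) :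
    ∀ t, 0 < t → Tendsto (fun i => l.foldr decr (f i) t) u (𝓝 (l.foldr decr g t)) := by
  induction l with
  | nil => exact h
  | cons s l ih =>
    intro t ht
    have hs : 0 < s := hl s (by simp)
    have ih := ih fun r hr => hl r (by simp [hr])
    simpa only [List.foldr_cons, decr] using (ih t ht).sub (ih (t + s) (by positivity))

namespace DiffCM

variable {f g : ℝ → ℝ}

lemma of_tendsto {ι : Type*} {u : Filter ι} [u.NeBot] {f : ι → ℝ → ℝ}
    (hf : ∀ᶠ i in u, DiffCM (f i)) (h : ∀ t, 0 < t → Tendsto (fun i => f i t) u (𝓝 (g t))) :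
    DiffCM g := fun l hl t ht =>
  ge_of_tendsto (tendsto_foldr_decr h l hl t ht) (hf.mono fun _ hi => hi l hl t ht)

lemma nonneg (hf : DiffCM f) {t : ℝ} (ht : 0 < t) : 0 ≤ f t := hf [] (by simp) t ht

lemma decr (hf : DiffCM f) {s : ℝ} (hs : 0 < s) : DiffCM (decr s f) := fun l hl t ht => by
  have := hf (l ++ [s]) (by
    intro r hr
    rcases List.mem_append.1 hr with h | h
    · exact hl r h
    · simp at h; exact h ▸ hs) t ht
  simpa [List.foldr_append] using this

lemma const_mul (hf : DiffCM f) {c : ℝ} (hc : 0 ≤ c) : DiffCM fun t => c * f t :=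
    fun l hl t ht => by
  have : ∀ (l : List ℝ) t, l.foldr _root_.decr (fun t => c * f t) t
      = c * l.foldr _root_.decr f t := by
    intro l
    induction l with
    | nil => intro t; rfl
    | cons s l ih => intro t; simp only [List.foldr_cons, _root_.decr, ih]; ring
  rw [this]
  exact mul_nonneg hc (hf l hl t ht)

lemma antitoneOn (hf : DiffCM f) : AntitoneOn f (Ioi 0) := by
  intro a ha b hb hab
  rcases hab.eq_or_lt with rfl | hab
  · rfl
  · have := (hf.decr (sub_pos.2 hab)).nonneg ha
    simp only [_root_.decr, add_sub_cancel] at this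
    linarith

end DiffCM

/-- An antitone function with antitone decrements is locally Lipschitz, with an explicit bound. -/
lemma decr_le_of_antitone_decr {f : ℝ → ℝ} (h1 : AntitoneOn f (Ioi 0))
    (h2 : ∀ s, 0 < s → AntitoneOn (decr s f) (Ioi 0)) {c a s : ℝ} (hc : 0 < c) (ha : 2 * c ≤ a)
    (hs : 0 < s) (hsc : s ≤ c) : f a - f (a + s) ≤ 2 * s / c * (f c - f a) := by
  have key : ∀ n : ℕ, n * s ≤ c → n * (f a - f (a + s)) ≤ f (a - n * s) - f a := by
    intro n
    induction n with
    | zero => simp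
    | succ n ih =>
      intro hn
      push_cast at hn ⊢
      have hn' : n * s ≤ c := by nlinarith
      have := h2 s hs (show a - (n + 1) * s ∈ Ioi 0 from by simp; linarith)
        (show a ∈ Ioi 0 from by simp; linarith) (by
          have : 0 ≤ ((n : ℝ) + 1) * s := by positivity
          linarith)
      simp only [decr] at this
      rw [show a - (n + 1) * s + s = a - n * s by ring] at this
      linarith [ih hn']
  have hn := Nat.floor_le (show 0 ≤ c / s by positivity)
  have hn1 := Nat.lt_floor_add_one (c / s)
  have hn2 : 1 ≤ ⌊c / s⌋₊ := (Nat.one_le_floor_iff _).2 ((one_le_div hs).2 hsc)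
  set n := ⌊c / s⌋₊
  have hns : n * s ≤ c := (le_div_iff₀ hs).1 hn
  have h3 := key n hns
  have h4 : f (a - n * s) ≤ f c :=
    h1 (show c ∈ Ioi 0 from hc) (show a - n * s ∈ Ioi 0 from by simp; linarith) (by linarith)
  have h5 : 0 ≤ f a - f (a + s) := sub_nonneg.2 (h1 (show a ∈ Ioi 0 from by simp; linarith)
    (show a + s ∈ Ioi 0 from by simp; linarith) (by linarith))
  have hn2' : (1 : ℝ) ≤ n := by exact_mod_cast hn2
  have h6 : c / s ≤ 2 * n := by linarith
  have h7 : c ≤ 2 * n * s := (div_le_iff₀ hs).1 h6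
  rw [div_mul_eq_mul_div, le_div_iff₀ hc]
  nlinarith

lemma continuousOn_of_antitone_decr {f : ℝ → ℝ} (h1 : AntitoneOn f (Ioi 0))
    (h2 : ∀ s, 0 < s → AntitoneOn (decr s f) (Ioi 0)) : ContinuousOn f (Ioi 0) := by
  intro x hx
  have hx : 0 < x := hx
  refine ContinuousAt.continuousWithinAt ?_
  set c := x / 4 with hc
  have hc0 : 0 < c := by positivity
  set K := 2 / c * (f c - f (2 * x))
  have hK : ∀ a b, 2 * c ≤ a → a < b → b ≤ 2 * x → b - a ≤ c →
      f b ≤ f a ∧ f a - f b ≤ K * (b - a) := by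
    intro a b ha hab hb hbc
    have h := decr_le_of_antitone_decr h1 h2 hc0 ha (sub_pos.2 hab) hbc
    rw [add_sub_cancel] at h
    have ha0 : a ∈ Ioi (0 : ℝ) := by simp; linarith
    refine ⟨h1 ha0 (by simp; linarith) hab.le, h.trans ?_⟩
    have : f (2 * x) ≤ f a := h1 ha0 (by simp; linarith) (by linarith)
    have h3 : 2 * (b - a) / c * (f c - f a) ≤ 2 * (b - a) / c * (f c - f (2 * x)) :=
      mul_le_mul_of_nonneg_left (by linarith) (div_nonneg (by linarith) hc0.le)
    refine h3.trans_eq ?_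
    simp only [K]
    ring
  have hb : ∀ᶠ y in 𝓝 x, |f y - f x| ≤ K * |y - x| := by
    filter_upwards [Ioo_mem_nhds (show x - c < x by linarith) (show x < x + c by linarith)]
      with y hy
    obtain ⟨hy1, hy2⟩ := hy
    rcases lt_trichotomy y x with h | rfl | h
    · obtain ⟨h3, h4⟩ := hK y x (by linarith) h (by linarith) (by linarith)
      rw [abs_of_nonneg (by linarith), abs_of_neg (by linarith)]
      linarith
    · simp
    · obtain ⟨h3, h4⟩ := hK x y (by linarith) h (by linarith) (by linarith)
      rw [abs_of_nonpos (by linarith), abs_of_pos (by linarith)]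
      linarith
  rw [ContinuousAt, tendsto_iff_norm_sub_tendsto_zero]
  refine squeeze_zero' (Eventually.of_forall fun _ => norm_nonneg _) hb ?_
  have : Tendsto (fun y => K * |y - x|) (𝓝 x) (𝓝 (K * |x - x|)) :=
    (Continuous.tendsto (by fun_prop) x)
  simpa using this

lemma convexOn_of_antitone_decr {f : ℝ → ℝ} (h1 : AntitoneOn f (Ioi 0))
    (h2 : ∀ s, 0 < s → AntitoneOn (decr s f) (Ioi 0)) : ConvexOn ℝ (Ioi 0) f := by
  have hcont := continuousOn_of_antitone_decr h1 h2
  have hint : ∀ a b, 0 < a → 0 < b → IntervalIntegrable f volume a b := fun a b ha hb =>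
    (hcont.mono fun x hx => (lt_min ha hb).trans_le hx.1).intervalIntegrable
  have hG : ∀ t, 0 < t → HasDerivAt (fun u => ∫ x in (1 : ℝ)..u, f x) (f t) t := fun t ht =>
    intervalIntegral.integral_hasDerivAt_right (hint 1 t one_pos ht)
      (hcont.stronglyMeasurableAtFilter isOpen_Ioi t ht) (hcont.continuousAt (Ioi_mem_nhds ht))
  set G := fun u => ∫ x in (1 : ℝ)..u, f x
  have hconv : ∀ ε, 0 < ε → ConvexOn ℝ (Ioi 0) fun t => ε⁻¹ * (G (t + ε) - G t) := by
    intro ε hε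
    have hd : ∀ t, 0 < t →
        HasDerivAt (fun t => ε⁻¹ * (G (t + ε) - G t)) (ε⁻¹ * (f (t + ε) - f t)) t := fun t ht =>
      (((hG (t + ε) (by positivity)).comp_add_const t ε).sub (hG t ht)).const_mul _
    have hdiff : DifferentiableOn ℝ (fun t => ε⁻¹ * (G (t + ε) - G t)) (Ioi 0) :=
      fun t ht => (hd t ht).differentiableAt.differentiableWithinAt
    refine MonotoneOn.convexOn_of_deriv (convex_Ioi 0) hdiff.continuousOn
      (hdiff.mono interior_subset) ?_
    rw [interior_Ioi]
    intro a ha b hb hab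
    rw [(hd a ha).deriv, (hd b hb).deriv]
    have := h2 ε hε ha hb hab
    simp only [decr] at this
    exact mul_le_mul_of_nonneg_left (by linarith) (by positivity)
  have hlim : ∀ t, 0 < t → Tendsto (fun ε => ε⁻¹ * (G (t + ε) - G t)) (𝓝[>] 0) (𝓝 (f t)) :=
    fun t ht => by simpa using (hG t ht).tendsto_slope_zero_right
  refine ⟨convex_Ioi 0, fun x hx y hy a b ha hb hab => ?_⟩
  refine le_of_tendsto_of_tendsto (hlim _ (convex_Ioi (0 : ℝ) hx hy ha hb hab))
    (((hlim x hx).const_mul a).add ((hlim y hy).const_mul b)) ?_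
  filter_upwards [self_mem_nhdsWithin] with ε hε
  simpa using (hconv ε hε).2 hx hy ha hb hab

/-- A function whose decrements are all completely monotone is differentiable, and its derivative
is the opposite of a completely monotone function. -/
lemma exists_hasDerivAt_of_decr {f : ℝ → ℝ} (hf : ∀ s, 0 < s → DiffCM (decr s f)) :
    ∃ g, DiffCM g ∧ ∀ t, 0 < t → HasDerivAt f (-g t) t := by
  have h1 : AntitoneOn f (Ioi 0) := by
    intro a ha b hb hab
    rcases hab.eq_or_lt with rfl | hab
    · rfl
    · have := (hf _ (sub_pos.2 hab)).nonneg ha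
      simp only [decr, add_sub_cancel] at this
      linarith
  have h2 : ∀ s, 0 < s → AntitoneOn (decr s f) (Ioi 0) := fun s hs => (hf s hs).antitoneOn
  have hcont := continuousOn_of_antitone_decr h1 h2
  have hconv := convexOn_of_antitone_decr h1 h2
  have hr : ∀ t, 0 < t → HasDerivWithinAt f (derivWithin f (Ioi t) t) (Ioi t) t := fun t ht =>
    hconv.hasDerivWithinAt_rightDeriv_of_mem_interior (by simpa using ht)
  set g := fun t => -derivWithin f (Ioi t) t
  have hg : DiffCM g := by
    refine DiffCM.of_tendsto (u := 𝓝[>] (0 : ℝ)) (f := fun s t => s⁻¹ * decr s f t) ?_ ?_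
    · filter_upwards [self_mem_nhdsWithin] with s hs
      exact (hf s hs).const_mul (inv_nonneg.2 (le_of_lt hs))
    · intro t ht
      have := (hasDerivWithinAt_iff_tendsto_slope' (by simp)).1 (hr t ht)
      have h3 : Tendsto (fun s : ℝ => t + s) (𝓝[>] 0) (𝓝[>] t) := by
        refine tendsto_nhdsWithin_iff.2 ⟨?_, ?_⟩
        · have : Tendsto (fun s : ℝ => t + s) (𝓝 0) (𝓝 (t + 0)) :=
            Continuous.tendsto (by fun_prop) _
          rw [add_zero] at this
          exact this.mono_left nhdsWithin_le_nhds
        · filter_upwards [self_mem_nhdsWithin] with s hs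
          simpa using hs
      refine (this.comp h3).neg.congr fun s => ?_
      simp only [Function.comp, slope_def_field, decr, add_sub_cancel_left]
      ring
  have hgc : ContinuousOn g (Ioi 0) := continuousOn_of_antitone_decr hg.antitoneOn
    fun s hs => (hg.decr hs).antitoneOn
  refine ⟨g, hg, fun t ht => ?_⟩
  have hint : ∀ a b, 0 < a → 0 < b → IntervalIntegrable g volume a b := fun a b ha hb =>
    (hgc.mono fun x hx => (lt_min ha hb).trans_le hx.1).intervalIntegrable
  have hG : HasDerivAt (fun u => ∫ x in (t / 2)..u, g x) (g t) t :=
    intervalIntegral.integral_hasDerivAt_right (hint _ t (by positivity) ht)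
      (hgc.stronglyMeasurableAtFilter isOpen_Ioi t ht) (hgc.continuousAt (Ioi_mem_nhds ht))
  have heq : (fun u => f (t / 2) - ∫ x in (t / 2)..u, g x) =ᶠ[𝓝 t] f := by
    filter_upwards [Ioi_mem_nhds (show t / 2 < t by linarith)] with u hu
    have hu : t / 2 < u := hu
    have ht2 : 0 < t / 2 := by positivity
    have := intervalIntegral.integral_eq_sub_of_hasDeriv_right_of_le (f' := fun x => -g x) hu.le
      (hcont.mono fun x hx => ht2.trans_le hx.1)
      (fun x hx => by simpa [g] using hr x (ht2.trans hx.1))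
      (hint _ _ ht2 (ht2.trans hu)).neg
    rw [intervalIntegral.integral_neg] at this
    linarith
  exact (hG.const_sub _).congr_of_eventuallyEq heq.symm

lemma DiffCM.contDiffOn {f : ℝ → ℝ} (hf : DiffCM f) : ContDiffOn ℝ (⊤ : ℕ∞) f (Ioi 0) := by
  refine contDiffOn_infty.2 fun n => ?_
  induction n generalizing f with
  | zero =>
    exact contDiffOn_zero.2 (continuousOn_of_antitone_decr hf.antitoneOn
      fun s hs => (hf.decr hs).antitoneOn)
  | succ n ih =>
    obtain ⟨g, hg, hd⟩ := exists_hasDerivAt_of_decr fun s hs => hf.decr hs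
    push_cast
    rw [contDiffOn_succ_iff_deriv_of_isOpen isOpen_Ioi]
    refine ⟨fun t ht => (hd t ht).differentiableAt.differentiableWithinAt, by simp, ?_⟩
    exact (ih hg).neg.congr fun t ht => (hd t ht).deriv

lemma DiffCM.iteratedDeriv_nonneg {f : ℝ → ℝ} (hf : DiffCM f) (n : ℕ) {t : ℝ} (ht : 0 < t) :
    0 ≤ (-1 : ℝ) ^ n * iteratedDeriv n f t := by
  induction n generalizing f with
  | zero => simpa using hf.nonneg ht
  | succ n ih =>
    obtain ⟨g, hg, hd⟩ := exists_hasDerivAt_of_decr fun s hs => hf.decr hs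
    have : deriv f =ᶠ[𝓝 t] fun x => -g x := by
      filter_upwards [Ioi_mem_nhds ht] with x hx using (hd x hx).deriv
    rw [iteratedDeriv_succ', this.iteratedDeriv_eq, iteratedDeriv_fun_neg]
    have := ih hg
    rw [pow_succ]
    linarith

/-- Complete monotonicity of order `k`, expressed by successive derivatives. -/
def DerivCM : ℕ → (ℝ → ℝ) → Prop
  | 0, f => ∀ t, 0 < t → 0 ≤ f t
  | k + 1, f => (∀ t, 0 < t → 0 ≤ f t) ∧
      ∃ g, (∀ t, 0 < t → HasDerivAt f (-g t) t) ∧ DerivCM k g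

lemma DerivCM.nonneg {k : ℕ} {f : ℝ → ℝ} (hf : DerivCM k f) {t : ℝ} (ht : 0 < t) : 0 ≤ f t := by
  cases k with
  | zero => exact hf t ht
  | succ k => exact hf.1 t ht

lemma DerivCM.antitoneOn {k : ℕ} {f : ℝ → ℝ} (hf : DerivCM (k + 1) f) :
    AntitoneOn f (Ioi 0) := by
  obtain ⟨_, g, hd, hg⟩ := hf
  refine antitoneOn_of_deriv_nonpos (convex_Ioi 0)
    (fun t ht => (hd t ht).continuousAt.continuousWithinAt)
    (fun t ht => (hd t (interior_subset ht)).differentiableAt.differentiableWithinAt) ?_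
  intro t ht
  have ht : 0 < t := interior_subset ht
  rw [(hd t ht).deriv]
  linarith [hg.nonneg ht]

lemma DerivCM.decr {k : ℕ} {f : ℝ → ℝ} (hf : DerivCM (k + 1) f) {s : ℝ} (hs : 0 < s) :
    DerivCM k (decr s f) := by
  have h0 : ∀ t, 0 < t → 0 ≤ _root_.decr s f t := fun t ht => sub_nonneg.2 <|
    hf.antitoneOn (mem_Ioi.2 ht) (mem_Ioi.2 (by linarith)) (by linarith)
  induction k generalizing f with
  | zero => exact h0
  | succ k ih =>
    obtain ⟨_, g, hd, hg⟩ := hf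
    refine ⟨h0, _root_.decr s g, fun t ht => ?_, ih hg fun t ht => sub_nonneg.2 <|
      hg.antitoneOn (mem_Ioi.2 ht) (mem_Ioi.2 (by linarith)) (by linarith)⟩
    refine ((hd t ht).sub ((hd (t + s) (by positivity)).comp_add_const t s)).congr_deriv ?_
    simp only [_root_.decr]
    ring

lemma seqCM_of_derivCM {f : ℝ → ℝ} (hf : ∀ k, DerivCM k f) {t₀ h : ℝ} (ht₀ : 0 < t₀)
    (hh : 0 < h) : SeqCM fun n => f (t₀ + n * h) := by
  intro k
  induction k generalizing f with
  | zero => exact fun n => (hf 0) _ (by positivity)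
  | succ k ih =>
    have : stepDiff 1 (fun n : ℕ => f (t₀ + n * h)) = fun n : ℕ => decr h f (t₀ + n * h) := by
      funext n
      simp only [stepDiff, decr]
      push_cast
      ring_nf
    rw [Function.iterate_succ_apply, this]
    exact ih fun k => (hf (k + 1)).decr hh

lemma derivCM_of_iteratedDeriv {f : ℝ → ℝ} (hc : ContDiffOn ℝ (⊤ : ℕ∞) f (Ioi 0))
    (hf : ∀ n : ℕ, ∀ t, 0 < t → 0 ≤ (-1 : ℝ) ^ n * iteratedDeriv n f t) (k : ℕ) : DerivCM k f := by
  induction k generalizing f with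
  | zero => exact fun t ht => by simpa using hf 0 t ht
  | succ k ih =>
    have hc' := (contDiffOn_infty_iff_deriv_of_isOpen isOpen_Ioi).1 hc
    refine ⟨fun t ht => by simpa using hf 0 t ht, fun t => -deriv f t, fun t ht => ?_, ?_⟩
    · simpa using ((hc'.1 t ht).differentiableAt (Ioi_mem_nhds ht)).hasDerivAt
    · refine ih hc'.2.neg fun n t ht => ?_
      have := hf (n + 1) t ht
      rw [iteratedDeriv_succ', pow_succ] at this
      rw [iteratedDeriv_fun_neg]
      linarith

lemma PosSemidef.trace_mul_nonneg {n : Type*} [Fintype n] [DecidableEq n] {M N : Matrix n n ℝ}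
    (hM : M.PosSemidef) (hN : N.PosSemidef) : 0 ≤ (M * N).trace := by
  obtain ⟨C, rfl⟩ := PosSemidef.exists_eq_transpose_mul_self hN
  rw [← Matrix.mul_assoc, trace_mul_comm, ← Matrix.mul_assoc]
  have := (hM.mul_mul_conjTranspose_same C).trace_nonneg
  rwa [conjTranspose_eq_transpose_of_trivial] at this

lemma PosDef.exists_sub_smul_one_posSemidef {n : Type*} [Fintype n] [DecidableEq n]
    {M : Matrix n n ℝ} (hM : M.PosDef) :
    ∃ c : ℝ, 0 < c ∧ (M - c • (1 : Matrix n n ℝ)).PosSemidef := by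
  cases subsingleton_or_nontrivial (Matrix n n ℝ) with
  | inl h =>
    refine ⟨1, one_pos, ?_⟩
    rw [Subsingleton.elim (M - _) 0]
    exact PosSemidef.zero
  | inr h =>
    open scoped MatrixOrder in
    obtain ⟨c, hc, hle⟩ := (CFC.exists_pos_algebraMap_le_iff hM.isHermitian.isSelfAdjoint).2
      fun x hx => hM.isStrictlyPositive.spectrum_pos hx
    refine ⟨c, hc, ?_⟩
    rw [Algebra.algebraMap_eq_smul_one] at hle
    exact Matrix.le_iff.1 hle

lemma SeqCM.add {f g : ℕ → ℝ} (hf : SeqCM f) (hg : SeqCM g) : SeqCM fun n => f n + g n := by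
  intro k
  induction k generalizing f g with
  | zero => exact fun n => add_nonneg (hf 0 n) (hg 0 n)
  | succ k ih =>
    intro n
    have : stepDiff 1 (fun n => f n + g n) = fun n => stepDiff 1 f n + stepDiff 1 g n := by
      funext n
      simp only [stepDiff]
      ring
    rw [Function.iterate_succ_apply, this]
    exact ih (fun k => hf (k + 1)) (fun k => hg (k + 1)) n

lemma seqCM_ite_eq_zero {c : ℝ} (hc : 0 ≤ c) : SeqCM fun n => if n = 0 then c else 0 := by
  intro k n
  have : stepDiff 1 (fun n => if n = 0 then c else 0) = fun n => if n = 0 then c else 0 := by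
    funext n
    simp [stepDiff]
  rw [Function.iterate_fixed this]
  dsimp only
  split_ifs <;> simp [hc]

/-- The increments of a function with completely monotone derivative are completely monotone. -/
lemma derivCM_increment {f g : ℝ → ℝ} (hd : ∀ t, 0 < t → HasDerivAt f (g t) t)
    (hg : ∀ k, DerivCM k g) {s : ℝ} (hs : 0 < s) (k : ℕ) : DerivCM k fun t => f (t + s) - f t := by
  have hmono : MonotoneOn f (Ioi 0) := by
    refine monotoneOn_of_deriv_nonneg (convex_Ioi 0)
      (fun t ht => (hd t ht).continuousAt.continuousWithinAt)
      (fun t ht => (hd t (interior_subset ht)).differentiableAt.differentiableWithinAt) ?_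
    intro t ht
    have ht : 0 < t := interior_subset ht
    rw [(hd t ht).deriv]
    exact (hg 0).nonneg ht
  have h0 : ∀ t, 0 < t → 0 ≤ f (t + s) - f t := fun t ht => sub_nonneg.2 <|
    hmono (mem_Ioi.2 ht) (mem_Ioi.2 (by linarith)) (by linarith)
  cases k with
  | zero => exact h0
  | succ k =>
    refine ⟨h0, decr s g, fun t ht => ?_, (hg (k + 1)).decr hs⟩
    refine (((hd (t + s) (by positivity)).comp_add_const t s).sub (hd t ht)).congr_deriv ?_
    simp only [decr]
    ring

section Bernstein

variable {m : ℕ} {A : ℝ → Matrix (Fin m) (Fin m) ℝ}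

lemma hasDerivAt_quadForm (hd : ∀ i j, DifferentiableOn ℝ (fun t => A t i j) (Ioi 0))
    (v : Fin m → ℝ) {t : ℝ} (ht : 0 < t) :
    HasDerivAt (fun t => quadForm v (A t)) (quadForm v (matDeriv m A t)) t := by
  have h : ∀ i j, HasDerivAt (fun t => A t i j) (matDeriv m A t i j) t := fun i j =>
    ((hd i j t ht).differentiableAt (Ioi_mem_nhds ht)).hasDerivAt
  have h2 : HasDerivAt (fun t => ∑ i, v i * ∑ j, A t i j * v j)
      (∑ i, v i * ∑ j, matDeriv m A t i j * v j) t :=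
    HasDerivAt.fun_sum fun i _ => (HasDerivAt.fun_sum fun j _ => (h i j).mul_const _).const_mul _
  exact h2

lemma MatCM.derivCM {A : ℝ → Matrix (Fin m) (Fin m) ℝ} (h : MatCM m A) (v : Fin m → ℝ) (k : ℕ) :
    DerivCM k fun t => quadForm v (A t) := by
  refine derivCM_of_iteratedDeriv ?_ (fun n t ht => h.2 v n t ht) k
  have : ContDiffOn ℝ (⊤ : ℕ∞) (fun t => ∑ i, v i * ∑ j, A t i j * v j) (Ioi 0) :=
    ContDiffOn.sum fun i _ => contDiffOn_const.mul
      (ContDiffOn.sum fun j _ => (h.1 i j).mul contDiffOn_const)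
  exact this

lemma MatBernstein.monotoneOn_quadForm (hA : MatBernstein m A) (v : Fin m → ℝ) :
    MonotoneOn (fun t => quadForm v (A t)) (Ioi 0) := by
  intro a ha b hb hab
  rcases hab.eq_or_lt with rfl | hab
  · rfl
  · have := derivCM_increment (fun t ht => hasDerivAt_quadForm hA.1 v ht) (hA.2.derivCM v)
      (sub_pos.2 hab) 0 a ha
    simp only [add_sub_cancel] at this
    simpa using this

lemma MatBernstein.posSemidef_sub (hA : MatBernstein m A)
    (hpsd : ∀ t ∈ Ioi (0 : ℝ), (A t).PosSemidef) {s t : ℝ} (hs : 0 < s) (hst : s ≤ t) :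
    (A t - A s).PosSemidef := by
  have ht : 0 < t := hs.trans_le hst
  refine posSemidef_iff_quadForm.2 ⟨?_, fun v => ?_⟩
  · rw [transpose_sub, (posSemidef_iff_quadForm.1 (hpsd t ht)).1,
      (posSemidef_iff_quadForm.1 (hpsd s hs)).1]
  · rw [map_sub]
    exact sub_nonneg.2 (hA.monotoneOn_quadForm v hs ht hst)

lemma MatBernstein.posDef (hA : MatBernstein m A) (hpsd : ∀ t ∈ Ioi (0 : ℝ), (A t).PosSemidef)
    (hnz : ∀ v : Fin m → ℝ, v ≠ 0 → ∃ t ∈ Ioi (0 : ℝ), v ⬝ᵥ (A t).mulVec v ≠ 0) {t : ℝ}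
    (ht : 0 < t) : (A t).PosDef := by
  refine PosDef.of_dotProduct_mulVec_pos (hpsd t ht).isHermitian fun v hv => ?_
  simp only [star_trivial]
  change 0 < quadForm v (A t)
  have h0 : ∀ s, 0 < s → 0 ≤ quadForm v (A s) := fun s hs =>
    (posSemidef_iff_quadForm.1 (hpsd s hs)).2 v
  refine (h0 t ht).lt_of_ne fun hz => ?_
  obtain ⟨s, hs, hne⟩ := hnz v hv
  have hs : 0 < s := hs
  refine hne ?_
  change quadForm v (A s) = 0
  have hmono := hA.monotoneOn_quadForm v
  refine le_antisymm ?_ (h0 s hs)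
  rcases le_total s t with hst | hts
  · exact (hmono hs ht hst).trans hz.ge
  · have hd := fun t ht => hasDerivAt_quadForm hA.1 v (t := t) ht
    have hzero : ∀ r, 0 < r → r ≤ t → quadForm v (A r) = 0 := fun r hr hrt =>
      le_antisymm ((hmono hr ht hrt).trans hz.ge) (h0 r hr)
    have hder : quadForm v (matDeriv m A (t / 2)) = 0 := by
      have : (fun t => quadForm v (A t)) =ᶠ[𝓝 (t / 2)] fun _ => 0 := by
        filter_upwards [Ioo_mem_nhds (show 0 < t / 2 by positivity) (show t / 2 < t by linarith)]
          with r hr using hzero r hr.1 hr.2.le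
      exact (hd (t / 2) (by positivity)).unique ((hasDerivAt_const _ _).congr_of_eventuallyEq this)
    have hanti : AntitoneOn (fun t => quadForm v (A t)) (Ici (t / 2)) := by
      refine antitoneOn_of_deriv_nonpos (convex_Ici _)
        (fun r hr => (hd r ((half_pos ht).trans_le hr)).continuousAt.continuousWithinAt)
        (fun r hr => (hd r ((half_pos ht).trans_le
          (interior_subset hr))).differentiableAt.differentiableWithinAt) ?_
      intro r hr
      have hr : t / 2 ≤ r := interior_subset hr
      rw [(hd r (by linarith)).deriv]
      exact ((hA.2.derivCM v 1).antitoneOn (show t / 2 ∈ Ioi 0 from half_pos ht)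
        (show r ∈ Ioi 0 from (half_pos ht).trans_le hr) hr).trans_eq hder
    exact (hanti (mem_Ici.2 (half_le_self ht.le)) (mem_Ici.2 (by linarith)) hts).trans hz.ge

/-- Convolution sums of `c` and the partial sums of `X`, when the increments of `c` form the
convolution inverse of `X`. -/
lemma sum_conv_partial_sums {n : Type*} [Fintype n] [DecidableEq n] {c X : ℕ → Matrix n n ℝ}
    (h : ∀ N, ∑ k ∈ Finset.range (N + 1), c (N - k) * X k = ((N : ℝ) + 1) • (1 : Matrix n n ℝ))
    (N : ℕ) :
    ∑ k ∈ Finset.range (N + 1), c (N - k) * ∑ j ∈ Finset.range (k + 1), X j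
      = (((N : ℝ) + 1) * (N + 2) / 2) • (1 : Matrix n n ℝ) := by
  induction N with
  | zero => simpa using h 0
  | succ N ih =>
    have h1 := h (N + 1)
    rw [Finset.sum_range_succ'] at h1 ⊢
    have h2 : ∀ k ∈ Finset.range (N + 1),
        c (N + 1 - (k + 1)) * ∑ j ∈ Finset.range (k + 1 + 1), X j
        = c (N - k) * ∑ j ∈ Finset.range (k + 1), X j + c (N + 1 - (k + 1)) * X (k + 1) := by
      intro k _
      rw [Finset.sum_range_succ _ (k + 1), Matrix.mul_add, Nat.add_sub_add_right]
    rw [Finset.sum_congr rfl h2, Finset.sum_add_distrib, ih, add_assoc]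
    simp only [zero_add, Finset.range_one, Finset.sum_singleton]
    rw [h1, ← add_smul]
    congr 1
    push_cast
    ring

lemma sum_conv_of_increments {n : Type*} [Fintype n] [DecidableEq n] {a c X : ℕ → Matrix n n ℝ}
    (h0 : a 0 = c 0) (hs : ∀ i, a (i + 1) = c (i + 1) - c i)
    (h : ∀ N, ∑ k ∈ Finset.range (N + 1), a (N - k) * X k = 1) (N : ℕ) :
    ∑ k ∈ Finset.range (N + 1), c (N - k) * X k = ((N : ℝ) + 1) • (1 : Matrix n n ℝ) := by
  induction N with
  | zero => simpa [h0] using h 0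
  | succ N ih =>
    have h1 := h (N + 1)
    rw [Finset.sum_range_succ] at h1 ⊢
    have h2 : ∀ k ∈ Finset.range (N + 1), c (N + 1 - k) * X k
        = a (N + 1 - k) * X k + c (N - k) * X k := by
      intro k hk
      have hk : k ≤ N := Nat.lt_succ_iff.1 (Finset.mem_range.1 hk)
      rw [Nat.sub_add_comm hk, hs, Matrix.sub_mul, sub_add_cancel]
    rw [Finset.sum_congr rfl h2, Finset.sum_add_distrib, ih]
    rw [Nat.sub_self, h0] at h1
    rw [Nat.sub_self, add_right_comm, h1]
    push_cast
    module

/-- Discretization of the equation `A ∗ Y = t² / 2` with step `h`. -/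
lemma MatBernstein.exists_discrete_solution (hA : MatBernstein m A)
    (hpsd : ∀ t ∈ Ioi (0 : ℝ), (A t).PosSemidef)
    (hnz : ∀ v : Fin m → ℝ, v ≠ 0 → ∃ t ∈ Ioi (0 : ℝ), v ⬝ᵥ (A t).mulVec v ≠ 0) {h : ℝ}
    (hh : 0 < h) :
    ∃ X : ℕ → Matrix (Fin m) (Fin m) ℝ,
      (∀ N, ∑ k ∈ Finset.range (N + 1), A (((N - k : ℕ) + 2 : ℝ) * h) * X k
        = ((N : ℝ) + 1) • (1 : Matrix (Fin m) (Fin m) ℝ)) ∧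
      (∀ N, (X N).PosSemidef) ∧ ∀ v, SeqCM fun N => quadForm v (X (N + 1)) := by
  have hsym : ∀ t, 0 < t → (A t)ᵀ = A t := fun t ht => (posSemidef_iff_quadForm.1 (hpsd t ht)).1
  set a : ℕ → Matrix (Fin m) (Fin m) ℝ := fun n =>
    A (h + n * h + h) - A (h + n * h) + if n = 0 then A h else 0 with ha
  have ha0 : a 0 = A (2 * h) := by
    simp [ha, two_mul]
  have hasym : ∀ i, (a i)ᵀ = a i := by
    intro i
    have h1 : 0 < h + i * h := by positivity
    simp only [ha]
    split_ifs <;> simp [hsym _ h1, hsym _ (h1.trans (lt_add_of_pos_right _ hh)), hsym _ hh]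
  have hdet : IsUnit (a 0).det := by
    rw [ha0]
    exact (hA.posDef hpsd hnz (by positivity)).det_pos.ne'.isUnit
  have hcm : ∀ v, SeqCM fun i => quadForm v (a i) := by
    intro v
    have h1 : SeqCM fun n : ℕ => quadForm v (A (h + n * h + h)) - quadForm v (A (h + n * h)) :=
      seqCM_of_derivCM (derivCM_increment (fun t ht => hasDerivAt_quadForm hA.1 v ht)
        (hA.2.derivCM v) hh) hh hh
    have h2 := h1.add (seqCM_ite_eq_zero ((posSemidef_iff_quadForm.1 (hpsd h hh)).2 v))
    convert h2 using 2 with n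
    simp only [ha, map_add, map_sub]
    split_ifs <;> simp
  obtain ⟨X, hX, hXp, hXc⟩ := exists_conv_inverse_of_seqCM a hasym hdet hcm
  refine ⟨X, fun N => ?_, hXp, hXc⟩
  refine sum_conv_of_increments (a := a) (c := fun j : ℕ => A ((j + 2 : ℝ) * h)) ?_ ?_ hX N
  · simp [ha0]
  · intro i
    simp only [ha, Nat.add_eq_zero_iff, one_ne_zero, and_false, if_false, add_zero]
    push_cast
    ring_nf

end Bernstein

lemma tendsto_natFloor_div_mul {h : ℕ → ℝ} (hpos : ∀ N, 0 < h N) (hlim : Tendsto h atTop (𝓝 0))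
    {t : ℝ} (ht : 0 ≤ t) : Tendsto (fun N => (⌊t / h N⌋₊ : ℝ) * h N) atTop (𝓝 t) := by
  have h1 : Tendsto (fun N => t - h N) atTop (𝓝 t) := by simpa using hlim.const_sub t
  refine tendsto_of_tendsto_of_tendsto_of_le_of_le h1 tendsto_const_nhds (fun N => ?_) fun N => ?_
  · have := Nat.lt_floor_add_one (t / h N)
    rw [div_lt_iff₀ (hpos N)] at this
    dsimp only
    linarith
  · have := Nat.floor_le (div_nonneg ht (hpos N).le)
    rwa [le_div_iff₀ (hpos N)] at this

/-- A selection theorem: discrete functions on grids of steps `h N → 0` that are locally bounded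
and equi-Lipschitz away from `0` have a subsequence converging locally on `(0,∞)`. -/
lemma exists_subseq_tendsto_grid {ι : Type*} [Countable ι] {y : ℕ → ℕ → ι → ℝ} {h : ℕ → ℝ}
    (hpos : ∀ N, 0 < h N) (hlim : Tendsto h atTop (𝓝 0)) {C : ℝ}
    (hb : ∀ i N n, |y N n i| ≤ C * (n * h N + 3))
    (hL : ∀ δ, 0 < δ → ∃ L, ∀ i N (n n' : ℕ), δ ≤ n * h N → n ≤ n' →
      |y N n' i - y N n i| ≤ L * (n' * h N - n * h N)) :
    ∃ φ : ℕ → ℕ, StrictMono φ ∧ ∃ Y : ι → ℝ → ℝ, ∀ i t, 0 < t → ∀ n : ℕ → ℕ,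
      Tendsto (fun N => n N * h (φ N)) atTop (𝓝 t) →
      Tendsto (fun N => y (φ N) (n N) i) atTop (𝓝 (Y i t)) := by
  have hsymm : ∀ δ, 0 < δ → ∃ L, 0 < L ∧ ∀ i N (n n' : ℕ), δ ≤ n * h N → δ ≤ n' * h N →
      |y N n' i - y N n i| ≤ L * |n' * h N - n * h N| := by
    intro δ hδ
    obtain ⟨L, hL⟩ := hL δ hδ
    have haux : ∀ i N (n n' : ℕ), δ ≤ n * h N → n ≤ n' →
        |y N n' i - y N n i| ≤ max L 1 * |n' * h N - n * h N| := fun i N n n' hn hnn =>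
      (hL i N n n' hn hnn).trans
        (mul_le_mul (le_max_left _ _) (le_abs_self _)
          (sub_nonneg.2 (mul_le_mul_of_nonneg_right (by exact_mod_cast hnn) (hpos N).le))
          (zero_le_one.trans (le_max_right _ _)))
    refine ⟨max L 1, by positivity, fun i N n n' hn hn' => ?_⟩
    rcases le_total n n' with hnn | hnn
    · exact haux i N n n' hn hnn
    · rw [abs_sub_comm, abs_sub_comm (_ * _)]
      exact haux i N n' n hn' hnn
  obtain ⟨w, -, φ, hφ, hw⟩ := (isCompact_univ_pi fun p : ℚ × ι =>
      isCompact_Icc (a := -(C * (|(p.1 : ℝ)| + 3))) (b := C * (|(p.1 : ℝ)| + 3))).tendsto_subseq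
    (x := fun N p => y N ⌊(p.1 : ℝ) / h N⌋₊ p.2) (by
      intro N p _
      rw [mem_Icc, ← abs_le]
      have hC : 0 ≤ C := by
        have := (abs_nonneg _).trans (hb p.2 0 0)
        simp only [Nat.cast_zero, zero_mul, zero_add] at this
        linarith
      refine (hb _ _ _).trans (mul_le_mul_of_nonneg_left ?_ hC)
      gcongr
      rcases le_total 0 (p.1 : ℝ) with hp | hp
      · have := Nat.floor_le (div_nonneg hp (hpos N).le)
        rw [le_div_iff₀ (hpos N)] at this
        exact this.trans (le_abs_self _)
      · rw [Nat.floor_of_nonpos (div_nonpos_of_nonpos_of_nonneg hp (hpos N).le)]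
        simp)
  have hw' : ∀ (q : ℚ) i, Tendsto (fun N => y (φ N) ⌊(q : ℝ) / h (φ N)⌋₊ i) atTop (𝓝 (w (q, i))) :=
    fun q i => (tendsto_pi_nhds.1 hw) (q, i)
  have hlim' : Tendsto (fun N => h (φ N)) atTop (𝓝 0) := hlim.comp hφ.tendsto_atTop
  have hfloor : ∀ t, 0 < t → Tendsto (fun N => (⌊t / h (φ N)⌋₊ : ℝ) * h (φ N)) atTop (𝓝 t) :=
    fun t ht => tendsto_natFloor_div_mul (fun N => hpos _) hlim' ht.le
  have hdiff : ∀ t, 0 < t → ∃ L, 0 < L ∧ ∀ i s, t / 2 < s → ∀ n n' : ℕ → ℕ,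
      Tendsto (fun N => n N * h (φ N)) atTop (𝓝 t) →
      Tendsto (fun N => n' N * h (φ N)) atTop (𝓝 s) →
      ∀ᶠ N in atTop, |y (φ N) (n' N) i - y (φ N) (n N) i|
        ≤ L * |n' N * h (φ N) - n N * h (φ N)| := by
    intro t ht
    obtain ⟨L, hL0, hL⟩ := hsymm (t / 2) (half_pos ht)
    refine ⟨L, hL0, fun i s hs n n' hn hn' => ?_⟩
    filter_upwards [hn.eventually_const_le (half_lt_self ht), hn'.eventually_const_le hs]
      with N h1 h2 using hL i _ _ _ h1 h2
  have hcau : ∀ i t, 0 < t → CauchySeq fun N => y (φ N) ⌊t / h (φ N)⌋₊ i := by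
    intro i t ht
    rw [Metric.cauchySeq_iff]
    intro ε hε
    obtain ⟨L, hL0, hL⟩ := hdiff t ht
    have hη : 0 < min (t / 2) (ε / (4 * L)) := by positivity
    obtain ⟨q, hq1, hq2⟩ := exists_rat_btwn (sub_lt_self t hη)
    have hq3 : t / 2 < q := by linarith [min_le_left (t / 2) (ε / (4 * L))]
    have hq4 : L * |(q : ℝ) - t| < ε / 4 := by
      rw [abs_of_neg (by linarith)]
      have : -((q : ℝ) - t) < ε / (4 * L) := by linarith [min_le_right (t / 2) (ε / (4 * L))]
      rw [lt_div_iff₀ (by positivity)] at this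
      linarith
    have hfq := hfloor q (by linarith)
    have h1 : ∀ᶠ N in atTop, |y (φ N) ⌊(q : ℝ) / h (φ N)⌋₊ i - y (φ N) ⌊t / h (φ N)⌋₊ i|
        < ε / 4 := by
      filter_upwards [hL i q hq3 _ _ (hfloor t ht) hfq,
        (((hfq.sub (hfloor t ht)).abs.const_mul L)).eventually_lt_const hq4] with N h1 h2
      exact h1.trans_lt h2
    have h2 := (Metric.tendsto_nhds.1 (hw' q i)) (ε / 4) (by positivity)
    obtain ⟨N₀, hN₀⟩ := eventually_atTop.1 (h1.and h2)
    refine ⟨N₀, fun a ha b hb => ?_⟩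
    obtain ⟨ha1, ha2⟩ := hN₀ a ha
    obtain ⟨hb1, hb2⟩ := hN₀ b hb
    rw [Real.dist_eq, abs_lt] at *
    constructor <;> linarith
  choose! Y hY using fun i t (ht : 0 < t) => cauchySeq_tendsto_of_complete (hcau i t ht)
  refine ⟨φ, hφ, Y, fun i t ht n hn => ?_⟩
  obtain ⟨L, hL0, hL⟩ := hdiff t ht
  have h1 : Tendsto (fun N => y (φ N) (n N) i - y (φ N) ⌊t / h (φ N)⌋₊ i) atTop (𝓝 0) := by
    refine squeeze_zero_norm' (hL i t (half_lt_self ht) _ _ (hfloor t ht) hn) ?_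
    simpa using (hn.sub (hfloor t ht)).abs.const_mul L
  simpa using h1.add (hY i t ht)

section Bernstein

variable {m : ℕ} {A : ℝ → Matrix (Fin m) (Fin m) ℝ}

lemma trace_sum_le_of_discrete_solution (hA : MatBernstein m A)
    (hpsd : ∀ t ∈ Ioi (0 : ℝ), (A t).PosSemidef) {c : ℝ} (hc : 0 < c)
    (hcA : (A 1 - c • (1 : Matrix (Fin m) (Fin m) ℝ)).PosSemidef) {h : ℝ} (hh : 0 < h) {p : ℕ}
    (hp : 1 ≤ p * h) {X : ℕ → Matrix (Fin m) (Fin m) ℝ} (hXp : ∀ N, (X N).PosSemidef)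
    (hX : ∀ N, ∑ k ∈ Finset.range (N + 1), A (((N - k : ℕ) + 2 : ℝ) * h) * X k
        = ((N : ℝ) + 1) • (1 : Matrix (Fin m) (Fin m) ℝ)) (n : ℕ) :
    ∑ k ∈ Finset.range (n + 1), (X k).trace ≤ m * (n + p + 1) / c := by
  have h1 := congrArg Matrix.trace (hX (n + p))
  rw [trace_sum, trace_smul, trace_one] at h1
  have h2 : ∑ k ∈ Finset.range (n + 1), c * (X k).trace
      ≤ ∑ k ∈ Finset.range (n + 1), (A (((n + p - k : ℕ) + 2 : ℝ) * h) * X k).trace := by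
    refine Finset.sum_le_sum fun k hk => ?_
    have hk : k ≤ n := Nat.lt_succ_iff.1 (Finset.mem_range.1 hk)
    have hge : 1 ≤ ((n + p - k : ℕ) + 2 : ℝ) * h := by
      have : (p : ℝ) ≤ (n + p - k : ℕ) := by exact_mod_cast (by omega)
      nlinarith
    have hps := (hA.posSemidef_sub hpsd one_pos hge).add hcA
    rw [sub_add_sub_cancel] at hps
    have := PosSemidef.trace_mul_nonneg hps (hXp k)
    rw [Matrix.sub_mul, trace_sub, smul_mul_assoc, one_mul, trace_smul, smul_eq_mul] at this
    linarith
  have h3 : ∑ k ∈ Finset.range (n + 1), (A (((n + p - k : ℕ) + 2 : ℝ) * h) * X k).trace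
      ≤ ∑ k ∈ Finset.range (n + p + 1), (A (((n + p - k : ℕ) + 2 : ℝ) * h) * X k).trace := by
    refine Finset.sum_le_sum_of_subset_of_nonneg
      (Finset.range_subset_range.2 (by omega)) fun k _ _ => ?_
    exact PosSemidef.trace_mul_nonneg (hpsd _ (mem_Ioi.2 (by positivity))) (hXp k)
  rw [le_div_iff₀ hc, mul_comm, Finset.mul_sum]
  refine (h2.trans h3).trans (h1.le.trans_eq ?_)
  simp
  ring

lemma SeqCM.const_mul {f : ℕ → ℝ} (hf : SeqCM f) {c : ℝ} (hc : 0 ≤ c) :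
    SeqCM fun n => c * f n := fun k n => by
  have := map_stepDiff_iterate (AddMonoidHom.mulLeft c) 1 k f n
  simp only [AddMonoidHom.coe_mulLeft] at this
  rw [this]
  exact mul_nonneg hc (hf k n)

lemma SeqCM.antitone {f : ℕ → ℝ} (hf : SeqCM f) : Antitone f :=
  antitone_nat_of_succ_le fun n => sub_nonneg.1 (by simpa [stepDiff] using hf 1 n)

lemma quadForm_single {n : Type*} [Fintype n] [DecidableEq n] (M : Matrix n n ℝ) (i : n) :
    quadForm (Pi.single i 1) M = M i i := by
  simp [quadForm_apply]

/-- Approximate solutions of `A ∗ Y = t² / 2` on the grid of step `h`. -/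
lemma MatBernstein.exists_grid_solution (hA : MatBernstein m A)
    (hpsd : ∀ t ∈ Ioi (0 : ℝ), (A t).PosSemidef)
    (hnz : ∀ v : Fin m → ℝ, v ≠ 0 → ∃ t ∈ Ioi (0 : ℝ), v ⬝ᵥ (A t).mulVec v ≠ 0) :
    ∃ C : ℝ, ∀ h : ℝ, 0 < h → h ≤ 1 → ∃ Y : ℕ → Matrix (Fin m) (Fin m) ℝ,
      (∀ N, ∑ k ∈ Finset.range (N + 1), A (((N - k : ℕ) + 2 : ℝ) * h) * Y k
        = (h * (N + 1) * (N + 2) / 2) • (1 : Matrix (Fin m) (Fin m) ℝ)) ∧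
      (∀ N, (Y N).PosSemidef) ∧ (∀ n, (Y n).trace ≤ C * (n * h + 3)) ∧
      (∀ n n', 0 < n → n ≤ n' → (Y n' - Y n).PosSemidef ∧
        n * (Y n' - Y n).trace ≤ C * (n * h + 3) * (n' - n)) ∧
      ∀ v, SeqCM fun N => quadForm v (Y (N + 1) - Y N) := by
  obtain ⟨c, hc, hcA⟩ := PosDef.exists_sub_smul_one_posSemidef (hA.posDef hpsd hnz one_pos)
  refine ⟨m / c, fun h hh hh1 => ?_⟩
  obtain ⟨X, hX, hXp, hXc⟩ := hA.exists_discrete_solution hpsd hnz hh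
  have htr : ∀ n, (h • ∑ k ∈ Finset.range (n + 1), X k).trace ≤ m / c * (n * h + 3) := by
    intro n
    have h1 := trace_sum_le_of_discrete_solution hA hpsd hc hcA hh (p := ⌈1 / h⌉₊)
      (by rw [← div_le_iff₀ hh]; exact Nat.le_ceil _) hXp hX n
    have h2 := Nat.ceil_lt_add_one (show 0 ≤ 1 / h by positivity)
    have h3 : h * (n + ⌈1 / h⌉₊ + 1) ≤ n * h + 3 := by
      have : h * ⌈1 / h⌉₊ ≤ h * (1 / h + 1) := mul_le_mul_of_nonneg_left h2.le hh.le
      rw [mul_add, mul_one_div_cancel hh.ne'] at this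
      nlinarith
    rw [trace_smul, trace_sum, smul_eq_mul]
    calc h * ∑ k ∈ Finset.range (n + 1), (X k).trace ≤ h * (m * (n + ⌈1 / h⌉₊ + 1) / c) :=
          mul_le_mul_of_nonneg_left h1 hh.le
      _ = m / c * (h * (n + ⌈1 / h⌉₊ + 1)) := by ring
      _ ≤ m / c * (n * h + 3) := mul_le_mul_of_nonneg_left h3 (by positivity)
  have hXanti : Antitone fun n => (X (n + 1)).trace := by
    intro a b hab
    simp only [trace, diag_apply]
    refine Finset.sum_le_sum fun i _ => ?_
    have := (hXc (Pi.single i 1)).antitone hab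
    simpa only [quadForm_single] using this
  have hdiff : ∀ n n', n ≤ n' → (∑ k ∈ Finset.range (n' + 1), X k) - ∑ k ∈ Finset.range (n + 1), X k
      = ∑ k ∈ Finset.Ico (n + 1) (n' + 1), X k := fun n n' hn =>
    (Finset.sum_Ico_eq_sub _ (by omega)).symm
  refine ⟨fun n => h • ∑ k ∈ Finset.range (n + 1), X k, fun N => ?_, fun N => ?_, htr, ?_, ?_⟩
  · simp only [mul_smul_comm]
    rw [← Finset.smul_sum,
      sum_conv_partial_sums (c := fun j : ℕ => A ((j + 2 : ℝ) * h)) hX, smul_smul]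
    congr 1
    ring
  · exact (posSemidef_sum _ fun k _ => hXp k).smul hh.le
  · intro n n' hn hnn
    rw [← smul_sub, hdiff n n' hnn]
    refine ⟨(posSemidef_sum _ fun k _ => hXp k).smul hh.le, ?_⟩
    have h1 : ∑ k ∈ Finset.Ico (n + 1) (n' + 1), (X k).trace ≤ (n' - n) * (X n).trace := by
      have : ∀ k ∈ Finset.Ico (n + 1) (n' + 1), (X k).trace ≤ (X n).trace := by
        intro k hk
        have hk := (Finset.mem_Ico.1 hk).1
        have := hXanti (show n - 1 ≤ k - 1 by omega)
        simp only at this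
        rwa [Nat.sub_add_cancel (by omega), Nat.sub_add_cancel (by omega)] at this
      refine (Finset.sum_le_card_nsmul _ _ _ this).trans_eq ?_
      rw [Nat.card_Ico, nsmul_eq_mul, Nat.add_sub_add_right, Nat.cast_sub hnn]
    have h2 : n * (X n).trace ≤ ∑ k ∈ Finset.range (n + 1), (X k).trace := by
      rw [Finset.sum_range_succ']
      have : ∀ k ∈ Finset.range n, (X n).trace ≤ (X (k + 1)).trace := by
        intro k hk
        have hk := Finset.mem_range.1 hk
        have := hXanti (show k ≤ n - 1 by omega)
        simp only at this
        rwa [Nat.sub_add_cancel (by omega)] at this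
      have h3 := Finset.card_nsmul_le_sum _ _ _ this
      rw [Finset.card_range, nsmul_eq_mul] at h3
      have := (hXp 0).trace_nonneg
      linarith
    have h3 := htr n
    rw [trace_smul, trace_sum, smul_eq_mul] at h3 ⊢
    have hnn' : (0 : ℝ) ≤ n' - n := sub_nonneg.2 (by exact_mod_cast hnn)
    calc n * (h * ∑ k ∈ Finset.Ico (n + 1) (n' + 1), (X k).trace)
        ≤ n * (h * ((n' - n) * (X n).trace)) := by gcongr
      _ = h * (n * (X n).trace) * (n' - n) := by ring
      _ ≤ m / c * (n * h + 3) * (n' - n) :=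
          mul_le_mul_of_nonneg_right ((mul_le_mul_of_nonneg_left h2 hh.le).trans h3) hnn'
  · intro v k n
    have : (fun N => quadForm v (h • ∑ k ∈ Finset.range (N + 1 + 1), X k
        - h • ∑ k ∈ Finset.range (N + 1), X k)) = fun N => h * quadForm v (X (N + 1)) := by
      funext N
      rw [← smul_sub, Finset.sum_range_succ _ (N + 1), add_sub_cancel_left, map_smul, smul_eq_mul]
    rw [this]
    exact (hXc v).const_mul hh.le k n

end Bernstein

lemma SeqCM.stepDiff_one {f : ℕ → ℝ} (hf : SeqCM f) : SeqCM (stepDiff 1 f) := fun k => hf (k + 1)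

lemma SeqCM.shift {f : ℕ → ℝ} (hf : SeqCM f) (p : ℕ) : SeqCM fun n => f (n + p) := by
  intro k
  induction k generalizing f with
  | zero => exact fun n => hf 0 (n + p)
  | succ k ih =>
    have : stepDiff 1 (fun n => f (n + p)) = fun n => stepDiff 1 f (n + p) := by
      funext n
      simp only [stepDiff, add_right_comm]
    rw [Function.iterate_succ_apply, this]
    exact ih hf.stepDiff_one

lemma seqCM_zero : SeqCM fun _ => 0 := by
  simpa using seqCM_ite_eq_zero le_rfl

lemma SeqCM.increment {f : ℕ → ℝ} (hf : SeqCM fun n => f (n + 1) - f n) (p : ℕ) :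
    SeqCM fun n => f (n + p) - f n := by
  induction p with
  | zero => simpa using seqCM_zero
  | succ p ih =>
    have := (hf.shift p).add ih
    refine cast (congrArg SeqCM (funext fun n => ?_)) this
    rw [sub_add_sub_cancel, add_assoc]

lemma SeqCM.stepDiff {f : ℕ → ℝ} (hf : SeqCM f) (p : ℕ) : SeqCM (stepDiff p f) := by
  have h : SeqCM fun n => (-f (n + 1)) - (-f n) := by
    refine cast (congrArg SeqCM (funext fun n => ?_)) hf.stepDiff_one
    simp only [_root_.stepDiff]
    ring
  refine cast (congrArg SeqCM (funext fun n => ?_)) (SeqCM.increment (f := fun n => -f n) h p)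
  simp only [_root_.stepDiff]
  ring

/-- Limits of completely monotone sequences on finer and finer grids are completely monotone. -/
lemma diffCM_of_grid_limit {h : ℕ → ℝ} (hpos : ∀ N, 0 < h N) (hlim : Tendsto h atTop (𝓝 0))
    {f : ℕ → ℕ → ℝ} {g : ℝ → ℝ} (hf : ∀ N, SeqCM (f N))
    (hfg : ∀ t, 0 < t → ∀ n : ℕ → ℕ, Tendsto (fun N => n N * h N) atTop (𝓝 t) →
      Tendsto (fun N => f N (n N)) atTop (𝓝 (g t))) : DiffCM g := by
  have key : ∀ l : List ℝ, (∀ s ∈ l, 0 < s) → ∃ f : ℕ → ℕ → ℝ, (∀ N, SeqCM (f N)) ∧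
      ∀ t, 0 < t → ∀ n : ℕ → ℕ, Tendsto (fun N => n N * h N) atTop (𝓝 t) →
        Tendsto (fun N => f N (n N)) atTop (𝓝 (l.foldr decr g t)) := by
    intro l hl
    induction l with
    | nil => exact ⟨f, hf, hfg⟩
    | cons s l ih =>
      obtain ⟨f', hf', hlim'⟩ := ih fun r hr => hl r (by simp [hr])
      have hs : 0 < s := hl s (by simp)
      refine ⟨fun N => stepDiff ⌊s / h N⌋₊ (f' N), fun N => (hf' N).stepDiff _,
        fun t ht n hn => ?_⟩
      simp only [List.foldr_cons, decr, stepDiff]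
      refine (hlim' t ht n hn).sub (hlim' (t + s) (by positivity) _ ?_)
      simpa [add_mul] using hn.add (tendsto_natFloor_div_mul hpos hlim hs.le)
  intro l hl t ht
  obtain ⟨f', hf', hlim'⟩ := key l hl
  exact ge_of_tendsto' (hlim' t ht _ (tendsto_natFloor_div_mul hpos hlim ht.le))
    fun N => hf' N 0 _

lemma integral_natFloor_div {h : ℝ} (hh : 0 < h) (u : ℕ → ℝ) (n : ℕ) :
    ∫ s in (0 : ℝ)..n * h, u ⌊s / h⌋₊ = h * ∑ k ∈ Finset.range n, u k := by
  have hcongr : ∀ k : ℕ, ∀ s ∈ Ioo ((k : ℝ) * h) ((k + 1 : ℕ) * h), u k = u ⌊s / h⌋₊ := by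
    intro k s hs
    rw [(Nat.floor_eq_iff (div_nonneg ((by positivity : 0 ≤ (k : ℝ) * h).trans hs.1.le) hh.le)).2]
    refine ⟨(le_div_iff₀ hh).2 hs.1.le, (div_lt_iff₀ hh).2 ?_⟩
    exact_mod_cast hs.2
  have hle : ∀ k : ℕ, (k : ℝ) * h ≤ (k + 1 : ℕ) * h := fun k => by
    push_cast
    nlinarith
  have hint : ∀ k : ℕ, IntervalIntegrable (fun s => u ⌊s / h⌋₊) volume (k * h)
      ((k + 1 : ℕ) * h) := by
    intro k
    rw [intervalIntegrable_iff_integrableOn_Ioo_of_le (hle k)]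
    exact (integrableOn_const (by simp)).congr_fun (hcongr k) measurableSet_Ioo
  have h1 := intervalIntegral.sum_integral_adjacent_intervals (n := n)
    (a := fun k : ℕ => (k : ℝ) * h) (f := fun s => u ⌊s / h⌋₊) (μ := volume) fun k _ => hint k
  simp only [Nat.cast_zero, zero_mul] at h1
  rw [← h1, Finset.mul_sum]
  refine Finset.sum_congr rfl fun k _ => ?_
  rw [intervalIntegral.integral_of_le (hle k), integral_Ioc_eq_integral_Ioo,
    ← setIntegral_congr_fun measurableSet_Ioo (hcongr k)]
  simp only [integral_const, MeasurableSet.univ, measureReal_restrict_apply, univ_inter,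
    Real.volume_real_Ioo_of_le (hle k), smul_eq_mul]
  push_cast
  ring

/-- Convergence of discrete convolutions to the convolution integral. -/
lemma tendsto_grid_conv {h : ℕ → ℝ} (hpos : ∀ N, 0 < h N) (hle1 : ∀ N, h N ≤ 1)
    (hlim : Tendsto h atTop (𝓝 0)) {u : ℝ → ℝ} (hu : ContinuousOn u (Ioi 0)) {t K K' : ℝ}
    (ht : 0 < t) (hK : ∀ s, 0 < s → s ≤ t + 3 → |u s| ≤ K) {y : ℕ → ℕ → ℝ} {Y : ℝ → ℝ}
    (hK' : ∀ N (n : ℕ), n * h N ≤ t → |y N n| ≤ K')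
    (hy : ∀ s, 0 < s → ∀ n : ℕ → ℕ, Tendsto (fun N => n N * h N) atTop (𝓝 s) →
      Tendsto (fun N => y N (n N)) atTop (𝓝 (Y s))) :
    Tendsto (fun N => h N * ∑ k ∈ Finset.range (⌊t / h N⌋₊ + 1),
      u (((⌊t / h N⌋₊ - k : ℕ) + 2 : ℝ) * h N) * y N k) atTop
      (𝓝 (∫ s in (0 : ℝ)..t, u s * Y (t - s))) := by
  set M : ℕ → ℕ := fun N => ⌊t / h N⌋₊ with hM
  have hMt : Tendsto (fun N => M N * h N) atTop (𝓝 t) := tendsto_natFloor_div_mul hpos hlim ht.le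
  have hMle : ∀ N, M N * h N ≤ t := fun N => by
    have := Nat.floor_le (div_nonneg ht.le (hpos N).le)
    rwa [le_div_iff₀ (hpos N)] at this
  set v : ℕ → ℕ → ℝ := fun N j => u ((j + 2 : ℝ) * h N) * y N (M N - j)
  set w : ℕ → ℝ → ℝ := fun N => (Iio (((M N + 1 : ℕ) : ℝ) * h N)).indicator fun s => v N ⌊s / h N⌋₊
  have hMle' : ∀ N, ((M N + 1 : ℕ) : ℝ) * h N ≤ t + 1 := fun N => by
    push_cast
    linarith [hMle N, hle1 N]
  have heq : ∀ N, h N * ∑ k ∈ Finset.range (M N + 1), u (((M N - k : ℕ) + 2 : ℝ) * h N) * y N k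
      = ∫ s in Ioc 0 (t + 1), w N s := by
    intro N
    have h1 : (0 : ℝ) ≤ ((M N + 1 : ℕ) : ℝ) * h N := by have := hpos N; positivity
    rw [← Finset.sum_range_reflect]
    have h2 : ∀ j ∈ Finset.range (M N + 1),
        u (((M N - (M N + 1 - 1 - j) : ℕ) + 2 : ℝ) * h N) * y N (M N + 1 - 1 - j) = v N j := by
      intro j hj
      have hj : j ≤ M N := Nat.lt_succ_iff.1 (Finset.mem_range.1 hj)
      simp only [v]
      rw [Nat.add_sub_cancel, Nat.sub_sub_self hj]
    rw [Finset.sum_congr rfl h2, ← integral_natFloor_div (hpos N),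
      intervalIntegral.integral_of_le h1, integral_Ioc_eq_integral_Ioo,
      integral_indicator measurableSet_Iio, Measure.restrict_restrict measurableSet_Iio]
    congr 2
    ext s
    simp only [mem_inter_iff, mem_Iio, mem_Ioc, mem_Ioo]
    have := hMle' N
    constructor
    · rintro ⟨h3, h4⟩
      exact ⟨h4, h3, by linarith⟩
    · rintro ⟨h3, h4, _⟩
      exact ⟨h4, h3⟩
  rw [funext heq]
  have hlimit : ∫ s in (0 : ℝ)..t, u s * Y (t - s)
      = ∫ s in Ioc 0 (t + 1), (Iio t).indicator (fun s => u s * Y (t - s)) s := by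
    rw [intervalIntegral.integral_of_le ht.le, integral_Ioc_eq_integral_Ioo,
      integral_indicator measurableSet_Iio, Measure.restrict_restrict measurableSet_Iio]
    congr 2
    ext s
    simp only [mem_inter_iff, mem_Iio, mem_Ioc, mem_Ioo]
    constructor
    · rintro ⟨h3, h4⟩
      exact ⟨h4, h3, by linarith⟩
    · rintro ⟨h3, h4, _⟩
      exact ⟨h4, h3⟩
  rw [hlimit]
  have hK0 : 0 ≤ K := (abs_nonneg _).trans (hK t ht (by linarith))
  have hK0' : 0 ≤ K' := (abs_nonneg _).trans (hK' 0 0 (by simpa using ht.le))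
  refine tendsto_integral_of_dominated_convergence (fun _ => K * K') (fun N => ?_) ?_
    (fun N => ?_) ?_
  · refine Measurable.aestronglyMeasurable (Measurable.indicator ?_ measurableSet_Iio)
    exact (measurable_of_countable (v N)).comp (Nat.measurable_floor.comp (by fun_prop))
  · exact integrableOn_const (by simp)
  · refine (ae_restrict_iff' measurableSet_Ioc).2 (Eventually.of_forall fun s hs => ?_)
    simp only [w, indicator, mem_Iio]
    split_ifs with hsM
    · have hfl : ⌊s / h N⌋₊ * h N ≤ s := by
        have := Nat.floor_le (div_nonneg hs.1.le (hpos N).le)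
        rwa [le_div_iff₀ (hpos N)] at this
      rw [norm_mul]
      refine mul_le_mul (hK _ ?_ ?_) (hK' _ _ ?_) (norm_nonneg _) hK0
      · have := hpos N
        positivity
      · have := hle1 N
        linarith [hs.2]
      · refine le_trans (mul_le_mul_of_nonneg_right ?_ (hpos N).le) (hMle N)
        exact_mod_cast Nat.sub_le _ _
    · simp only [norm_zero]
      positivity
  · have hne : ∀ᵐ s : ℝ, s ≠ t := by simp [ae_iff]
    refine (ae_restrict_iff' measurableSet_Ioc).2 (hne.mono fun s hst hs => ?_)
    rcases lt_or_gt_of_ne hst with hst | hst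
    · have hfl := tendsto_natFloor_div_mul hpos hlim hs.1.le
      have hflM : ∀ N, ⌊s / h N⌋₊ ≤ M N := fun N =>
        Nat.floor_le_floor (div_le_div_of_nonneg_right hst.le (hpos N).le)
      have h1 : Tendsto (fun N => u ((⌊s / h N⌋₊ + 2 : ℝ) * h N)) atTop (𝓝 (u s)) := by
        refine ((hu.continuousAt (Ioi_mem_nhds hs.1)).tendsto).comp ?_
        have := hfl.add (hlim.const_mul 2)
        simp only [mul_zero, add_zero] at this
        exact this.congr fun N => by ring
      have h2 : Tendsto (fun N => y N (M N - ⌊s / h N⌋₊)) atTop (𝓝 (Y (t - s))) := by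
        refine hy _ (sub_pos.2 hst) _ ((hMt.sub hfl).congr fun N => ?_)
        rw [Nat.cast_sub (hflM N), sub_mul]
      rw [indicator_of_mem (mem_Iio.2 hst)]
      refine (h1.mul h2).congr' ?_
      refine Eventually.of_forall fun N => ?_
      have hmem : s ∈ Iio (((M N + 1 : ℕ) : ℝ) * h N) := by
        have := Nat.lt_floor_add_one (t / h N)
        rw [div_lt_iff₀ (hpos N)] at this
        simp only [mem_Iio]
        push_cast
        linarith
      simp only [w]
      rw [indicator_of_mem hmem]
    · rw [indicator_of_notMem (by simp [hst.le])]
      have h1 : Tendsto (fun N => ((M N + 1 : ℕ) : ℝ) * h N) atTop (𝓝 t) := by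
        have := hMt.add hlim
        rw [add_zero] at this
        exact this.congr fun N => by push_cast; ring
      refine tendsto_const_nhds.congr' ?_
      filter_upwards [h1.eventually_lt_const hst] with N hN
      simp only [w]
      rw [indicator_of_notMem (by simpa using hN.le)]

section Bernstein

variable {m : ℕ} {A : ℝ → Matrix (Fin m) (Fin m) ℝ}

lemma MatBernstein.continuousOn_apply (hA : MatBernstein m A) (i j : Fin m) :
    ContinuousOn (fun t => A t i j) (Ioi 0) := (hA.1 i j).continuousOn

lemma MatBernstein.abs_apply_le (hA : MatBernstein m A)
    (hpsd : ∀ t ∈ Ioi (0 : ℝ), (A t).PosSemidef) {s T : ℝ} (hs : 0 < s) (hsT : s ≤ T)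
    (i j : Fin m) : |A s i j| ≤ (A T).trace := by
  refine (PosSemidef.abs_apply_le_trace (hpsd s hs) i j).trans ?_
  have := (hA.posSemidef_sub hpsd hs hsT).trace_nonneg
  rw [trace_sub] at this
  linarith

lemma MatBernstein.exists_primitive_solution (hA : MatBernstein m A)
    (hpsd : ∀ t ∈ Ioi (0 : ℝ), (A t).PosSemidef)
    (hnz : ∀ v : Fin m → ℝ, v ≠ 0 → ∃ t ∈ Ioi (0 : ℝ), v ⬝ᵥ (A t).mulVec v ≠ 0) :
    ∃ Y : ℝ → Matrix (Fin m) (Fin m) ℝ,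
      (∀ t, 0 < t → (Y t).PosSemidef) ∧
      (∀ v, ∃ g, DiffCM g ∧ ∀ t, 0 < t → HasDerivAt (fun t => quadForm v (Y t)) (g t) t) ∧
      ∀ t, 0 < t → ∀ i j, ∑ l, ∫ s in (0 : ℝ)..t, A s i l * Y (t - s) l j
        = ((t ^ 2 / 2) • (1 : Matrix (Fin m) (Fin m) ℝ)) i j := by
  obtain ⟨C, hC⟩ := hA.exists_grid_solution hpsd hnz
  have hpos : ∀ N : ℕ, 0 < 1 / ((N : ℝ) + 1) := fun N => by positivity
  have hle1 : ∀ N : ℕ, 1 / ((N : ℝ) + 1) ≤ 1 := fun N => by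
    rw [div_le_one (by positivity)]
    linarith [(Nat.cast_nonneg N : (0 : ℝ) ≤ N)]
  choose y hyeq hypsd hytr hydiff hycm using fun N : ℕ => hC _ (hpos N) (hle1 N)
  have hlim : Tendsto (fun N : ℕ => 1 / ((N : ℝ) + 1)) atTop (𝓝 0) :=
    tendsto_one_div_add_atTop_nhds_zero_nat
  set h : ℕ → ℝ := fun N => 1 / ((N : ℝ) + 1)
  have hC0 : 0 ≤ C := by
    have := (hypsd 0 0).trace_nonneg.trans (hytr 0 0)
    simp only [Nat.cast_zero, zero_mul, zero_add] at this
    linarith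
  obtain ⟨φ, hφ, Yf, hYf⟩ := exists_subseq_tendsto_grid (ι := Fin m × Fin m)
    (y := fun N n p => y N n p.1 p.2) hpos hlim (C := C)
    (fun p N n => (PosSemidef.abs_apply_le_trace (hypsd N n) _ _).trans (hytr N n)) (by
      intro δ hδ
      refine ⟨C * (1 + 3 / δ), fun p N n n' hn hnn => ?_⟩
      have hn0 : 0 < n := by
        rcases Nat.eq_zero_or_pos n with rfl | h0
        · simp only [Nat.cast_zero, zero_mul] at hn
          linarith
        · exact h0
      obtain ⟨h1, h2⟩ := hydiff N n n' hn0 hnn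
      refine (PosSemidef.abs_apply_le_trace h1 p.1 p.2).trans ?_
      have h3 : n * h N + 3 ≤ n * h N * (1 + 3 / δ) := by
        have : 3 ≤ n * h N * (3 / δ) := by
          rw [← mul_div_assoc, le_div_iff₀ hδ]
          linarith
        linarith
      have hnh : (0 : ℝ) ≤ n' * h N - n * h N :=
        sub_nonneg.2 (mul_le_mul_of_nonneg_right (by exact_mod_cast hnn) (hpos N).le)
      refine le_of_mul_le_mul_left ?_ (hδ.trans_le hn)
      calc n * h N * (y N n' - y N n).trace = n * (y N n' - y N n).trace * h N := by ring
        _ ≤ C * (n * h N + 3) * (n' - n) * h N := mul_le_mul_of_nonneg_right h2 (hpos N).le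
        _ = C * (n' * h N - n * h N) * (n * h N + 3) := by ring
        _ ≤ C * (n' * h N - n * h N) * (n * h N * (1 + 3 / δ)) :=
            mul_le_mul_of_nonneg_left h3 (mul_nonneg hC0 hnh)
        _ = n * h N * (C * (1 + 3 / δ) * (n' * h N - n * h N)) := by ring)
  have hpos' := fun N => hpos (φ N)
  have hlim' : Tendsto (fun N => h (φ N)) atTop (𝓝 0) := hlim.comp hφ.tendsto_atTop
  set Y : ℝ → Matrix (Fin m) (Fin m) ℝ := fun t => Matrix.of fun i j => Yf (i, j) t
  have hY : ∀ t, 0 < t → ∀ n : ℕ → ℕ, Tendsto (fun N => n N * h (φ N)) atTop (𝓝 t) →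
      Tendsto (fun N => y (φ N) (n N)) atTop (𝓝 (Y t)) := fun t ht n hn =>
    tendsto_matrix fun i j => hYf (i, j) t ht n hn
  have hfloor := fun t (ht : 0 ≤ t) => tendsto_natFloor_div_mul hpos' hlim' ht
  refine ⟨Y, fun t ht => ?_, fun v => ?_, fun t ht i j => ?_⟩
  · exact isClosed_posSemidef.mem_of_tendsto (hY t ht _ (hfloor t ht.le))
      (Eventually.of_forall fun N => hypsd _ _)
  · obtain ⟨g, hg, hd⟩ := exists_hasDerivAt_of_decr (f := fun t => -quadForm v (Y t)) (by
      intro s hs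
      refine diffCM_of_grid_limit hpos' hlim' (f := fun N n =>
        quadForm v (y (φ N) (n + ⌊s / h (φ N)⌋₊)) - quadForm v (y (φ N) n)) (fun N => ?_) ?_
      · exact SeqCM.increment (f := fun n => quadForm v (y (φ N) n))
          (by simpa only [map_sub] using hycm (φ N) v) _
      · intro t ht n hn
        have h1 : Tendsto (fun N => ((n N + ⌊s / h (φ N)⌋₊ : ℕ) : ℝ) * h (φ N)) atTop
            (𝓝 (t + s)) := by
          simp only [Nat.cast_add, add_mul]
          exact hn.add (hfloor s hs.le)
        have h2 := (((continuous_quadForm v).tendsto _).comp (hY _ (by positivity) _ h1)).sub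
          (((continuous_quadForm v).tendsto _).comp (hY t ht n hn))
        simp only [decr]
        rwa [neg_sub_neg])
    exact ⟨g, hg, fun t ht => by simpa using (hd t ht).fun_neg⟩
  · have h1 : Tendsto (fun N => ∑ l, h (φ N) * ∑ k ∈ Finset.range (⌊t / h (φ N)⌋₊ + 1),
        A (((⌊t / h (φ N)⌋₊ - k : ℕ) + 2 : ℝ) * h (φ N)) i l * y (φ N) k l j) atTop
        (𝓝 (∑ l, ∫ s in (0 : ℝ)..t, A s i l * Y (t - s) l j)) := by
      refine tendsto_finsetSum _ fun l _ => ?_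
      refine tendsto_grid_conv (u := fun s => A s i l) (y := fun N n => y (φ N) n l j)
        (Y := fun s => Y s l j) hpos' (fun N => hle1 _) hlim' (hA.continuousOn_apply i l) ht
        (K := (A (t + 3)).trace) (K' := C * (t + 3))
        (fun s hs hst => hA.abs_apply_le hpsd hs hst _ _)
        (fun N n hn => ?_) (fun s hs n hn => (hY s hs n hn).matrix_apply l j)
      refine (PosSemidef.abs_apply_le_trace (hypsd _ _) _ _).trans ((hytr _ _).trans ?_)
      exact mul_le_mul_of_nonneg_left (by linarith) hC0
    have h2 : ∀ N, ∑ l, h (φ N) * ∑ k ∈ Finset.range (⌊t / h (φ N)⌋₊ + 1),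
        A (((⌊t / h (φ N)⌋₊ - k : ℕ) + 2 : ℝ) * h (φ N)) i l * y (φ N) k l j
        = (((⌊t / h (φ N)⌋₊ * h (φ N) + h (φ N)) * (⌊t / h (φ N)⌋₊ * h (φ N) + 2 * h (φ N)) / 2) •
          (1 : Matrix (Fin m) (Fin m) ℝ)) i j := by
      intro N
      have := congrFun (congrFun (hyeq (φ N) ⌊t / h (φ N)⌋₊) i) j
      rw [Matrix.sum_apply] at this
      simp only [Matrix.mul_apply, Matrix.smul_apply, smul_eq_mul] at this ⊢
      rw [Finset.sum_comm] at this
      rw [← Finset.mul_sum, this]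
      ring
    rw [funext h2] at h1
    refine tendsto_nhds_unique h1 ?_
    simp only [Matrix.smul_apply, smul_eq_mul]
    have h3 := (((hfloor t ht.le).add hlim').mul ((hfloor t ht.le).add (hlim'.const_mul 2)))
    simp only [mul_zero, add_zero, ← sq] at h3
    exact (h3.div_const 2).mul_const _

end Bernstein

/-- The convolution `∫₀ᵗ f(s) g(t-s) ds` of scalar functions on the half-line. -/
def halfConv (f g : ℝ → ℝ) (t : ℝ) : ℝ := ∫ s in (0 : ℝ)..t, f s * g (t - s)

/-- Continuous functions on `(0,∞)` that are integrable near `0`. -/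
def LocInt (f : ℝ → ℝ) : Prop := ContinuousOn f (Ioi 0) ∧ ∀ T, IntegrableOn f (Ioc 0 T)

/-- Continuous functions on `(0,∞)` that are bounded near `0`. -/
def LocBdd (f : ℝ → ℝ) : Prop :=
  ContinuousOn f (Ioi 0) ∧ ∀ T, ∃ K, ∀ s, 0 < s → s ≤ T → |f s| ≤ K

lemma ContinuousOn.aestronglyMeasurable_restrict_Ioc {f : ℝ → ℝ} (hf : ContinuousOn f (Ioi 0))
    (T : ℝ) : AEStronglyMeasurable f (volume.restrict (Ioc 0 T)) :=
  (hf.mono Ioc_subset_Ioi_self).aestronglyMeasurable measurableSet_Ioc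

lemma LocBdd.locInt {f : ℝ → ℝ} (hf : LocBdd f) : LocInt f := by
  refine ⟨hf.1, fun T => ?_⟩
  obtain ⟨K, hK⟩ := hf.2 T
  exact Integrable.mono' (integrable_const K) (hf.1.aestronglyMeasurable_restrict_Ioc T)
    ((ae_restrict_iff' measurableSet_Ioc).2 (Eventually.of_forall fun s hs => hK s hs.1 hs.2))

lemma LocInt.intervalIntegrable {f : ℝ → ℝ} (hf : LocInt f) {t : ℝ} (ht : 0 ≤ t) :
    IntervalIntegrable f volume 0 t :=
  (intervalIntegrable_iff_integrableOn_Ioc_of_le ht).2 (hf.2 t)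

lemma LocBdd.of_continuous {f : ℝ → ℝ} (hf : Continuous f) : LocBdd f := by
  refine ⟨hf.continuousOn, fun T => ?_⟩
  obtain ⟨K, hK⟩ := isCompact_Icc.exists_bound_of_continuousOn (s := Icc 0 T) hf.continuousOn
  exact ⟨K, fun s hs hsT => hK s ⟨hs.le, hsT⟩⟩

lemma LocBdd.add {f g : ℝ → ℝ} (hf : LocBdd f) (hg : LocBdd g) : LocBdd fun t => f t + g t := by
  refine ⟨hf.1.add hg.1, fun T => ?_⟩
  obtain ⟨K, hK⟩ := hf.2 T
  obtain ⟨K', hK'⟩ := hg.2 T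
  exact ⟨K + K', fun s hs hsT => (abs_add_le _ _).trans (add_le_add (hK s hs hsT) (hK' s hs hsT))⟩

lemma LocBdd.mul {f g : ℝ → ℝ} (hf : LocBdd f) (hg : LocBdd g) : LocBdd fun t => f t * g t := by
  refine ⟨hf.1.mul hg.1, fun T => ?_⟩
  obtain ⟨K, hK⟩ := hf.2 T
  obtain ⟨K', hK'⟩ := hg.2 T
  refine ⟨K * K', fun s hs hsT => ?_⟩
  rw [abs_mul]
  exact mul_le_mul (hK s hs hsT) (hK' s hs hsT) (abs_nonneg _) ((abs_nonneg _).trans (hK s hs hsT))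

lemma LocBdd.sum {ι : Type*} {s : Finset ι} {f : ι → ℝ → ℝ} (hf : ∀ i ∈ s, LocBdd (f i)) :
    LocBdd fun t => ∑ i ∈ s, f i t := by
  classical
  induction s using Finset.induction_on with
  | empty => simpa using LocBdd.of_continuous continuous_const
  | insert a s ha ih =>
    simp only [Finset.sum_insert ha]
    exact (hf a (by simp)).add (ih fun i hi => hf i (by simp [hi]))

lemma halfConv_comm (f g : ℝ → ℝ) (t : ℝ) : halfConv f g t = halfConv g f t := by
  have := intervalIntegral.integral_comp_sub_left (a := 0) (b := t) (fun s => g s * f (t - s)) t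
  simpa only [halfConv, sub_sub_cancel, sub_zero, sub_self, mul_comm (g _)] using this

lemma halfConv_intervalIntegrable {f g : ℝ → ℝ} (hf : LocBdd f) (hg : LocInt g) {t : ℝ}
    (ht : 0 ≤ t) : IntervalIntegrable (fun s => f s * g (t - s)) volume 0 t := by
  have h1 := (hg.intervalIntegrable ht).comp_sub_left t
  simp only [sub_zero, sub_self] at h1
  replace h1 := h1.symm
  rw [intervalIntegrable_iff_integrableOn_Ioc_of_le ht] at h1 ⊢
  obtain ⟨K, hK⟩ := hf.2 t
  exact Integrable.bdd_mul h1 (hf.1.aestronglyMeasurable_restrict_Ioc t)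
    ((ae_restrict_iff' measurableSet_Ioc).2 (Eventually.of_forall fun s hs => hK s hs.1 hs.2))

lemma halfConv_congr {f f' g g' : ℝ → ℝ} {t : ℝ} (ht : 0 ≤ t) (hf : ∀ s, 0 < s → f s = f' s)
    (hg : ∀ s, 0 < s → g s = g' s) : halfConv f g t = halfConv f' g' t := by
  simp only [halfConv]
  rw [intervalIntegral.integral_of_le ht, intervalIntegral.integral_of_le ht,
    integral_Ioc_eq_integral_Ioo, integral_Ioc_eq_integral_Ioo]
  refine setIntegral_congr_fun measurableSet_Ioo fun s hs => ?_
  simp only [hf s hs.1, hg (t - s) (sub_pos.2 hs.2)]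

lemma halfConv_sum_left {ι : Type*} {u : Finset ι} {f : ι → ℝ → ℝ} {g : ℝ → ℝ}
    (hf : ∀ i ∈ u, LocBdd (f i)) (hg : LocInt g) {t : ℝ} (ht : 0 ≤ t) :
    halfConv (fun s => ∑ i ∈ u, f i s) g t = ∑ i ∈ u, halfConv (f i) g t := by
  simp only [halfConv, Finset.sum_mul]
  exact intervalIntegral.integral_finsetSum fun i hi => halfConv_intervalIntegrable (hf i hi) hg ht

lemma halfConv_sum_right {ι : Type*} {u : Finset ι} {f : ι → ℝ → ℝ} {g : ℝ → ℝ}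
    (hf : ∀ i ∈ u, LocBdd (f i)) (hg : LocInt g) {t : ℝ} (ht : 0 ≤ t) :
    halfConv g (fun s => ∑ i ∈ u, f i s) t = ∑ i ∈ u, halfConv g (f i) t := by
  rw [halfConv_comm, halfConv_sum_left hf hg ht]
  exact Finset.sum_congr rfl fun i _ => halfConv_comm _ _ _

lemma integral_mul_sub_eq_halfConv {φ ψ f g : ℝ → ℝ} {t : ℝ} (ht : 0 ≤ t)
    (hφ0 : ∀ s, s ≤ 0 → φ s = 0) (hψ0 : ∀ s, s ≤ 0 → ψ s = 0)
    (hφ : ∀ s, 0 < s → s < t → φ s = f s) (hψ : ∀ s, 0 < s → s < t → ψ s = g s) :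
    ∫ s, φ s * ψ (t - s) = halfConv f g t := by
  rw [halfConv, intervalIntegral.integral_of_le ht, integral_Ioc_eq_integral_Ioo,
    ← integral_indicator measurableSet_Ioo]
  refine integral_congr_ae (Eventually.of_forall fun s => ?_)
  by_cases hs : s ∈ Ioo 0 t
  · rw [indicator_of_mem hs]
    dsimp only
    rw [hφ s hs.1 hs.2, hψ (t - s) (by linarith [hs.2]) (by linarith [hs.1])]
  · rw [indicator_of_notMem hs]
    rcases le_or_gt s 0 with h | h
    · simp [hφ0 s h]
    · have : t ≤ s := by
        by_contra hts
        exact hs ⟨h, not_le.1 hts⟩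
      simp [hψ0 (t - s) (by linarith)]

lemma halfConv_assoc {f g k : ℝ → ℝ} (hf : LocBdd f) (hg : LocInt g) (hk : LocInt k) {t : ℝ}
    (ht : 0 < t) : halfConv (halfConv f g) k t = halfConv f (halfConv g k) t := by
  set cut : (ℝ → ℝ) → ℝ → ℝ := fun f => (Ioc 0 t).indicator f with hcut
  have hint : ∀ {f : ℝ → ℝ}, LocInt f → Integrable (cut f) := fun hf =>
    (integrable_indicator_iff measurableSet_Ioc).2 (hf.2 t)
  have h0 : ∀ (f : ℝ → ℝ) s, s ≤ 0 → cut f s = 0 := fun f s hs =>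
    indicator_of_notMem (fun h => absurd h.1 (not_lt.2 hs)) _
  have h1 : ∀ (f : ℝ → ℝ) s, 0 < s → s ≤ t → cut f s = f s := fun f s hs hst =>
    indicator_of_mem (mem_Ioc.2 ⟨hs, hst⟩) _
  have hc0 : ∀ (f g : ℝ → ℝ) s, s ≤ 0 →
      convolution (cut f) (cut g) (ContinuousLinearMap.mul ℝ ℝ) volume s = 0 := by
    intro f g s hs
    rw [convolution_def]
    refine integral_eq_zero_of_ae (Eventually.of_forall fun r => ?_)
    rcases le_or_gt r 0 with h | h
    · simp [h0 f r h]
    · simp [h0 g (s - r) (by linarith)]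
  have hc1 : ∀ (f g : ℝ → ℝ) s, 0 < s → s ≤ t →
      convolution (cut f) (cut g) (ContinuousLinearMap.mul ℝ ℝ) volume s = halfConv f g s := by
    intro f g s hs hst
    rw [convolution_def]
    exact integral_mul_sub_eq_halfConv hs.le (h0 f) (h0 g)
      (fun r hr hrs => h1 f r hr (hrs.le.trans hst)) (fun r hr hrs => h1 g r hr (hrs.le.trans hst))
  have hassoc := convolution_assoc (L := ContinuousLinearMap.mul ℝ ℝ)
    (L₂ := ContinuousLinearMap.mul ℝ ℝ) (L₃ := ContinuousLinearMap.mul ℝ ℝ)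
    (L₄ := ContinuousLinearMap.mul ℝ ℝ) (f := cut f) (g := cut g) (k := cut k)
    (μ := volume) (ν := volume) (x₀ := t)
    (fun x y z => by simp [mul_assoc]) (hint hf.locInt).aestronglyMeasurable
    (hint hg).aestronglyMeasurable (hint hk).aestronglyMeasurable
    ((hint hf.locInt).ae_convolution_exists _ (hint hg))
    ((hint hg).norm.ae_convolution_exists _ (hint hk).norm) (by
      have h2 := (hint hg).norm.integrable_convolution (ContinuousLinearMap.mul ℝ ℝ)
        (hint hk).norm
      obtain ⟨K, hK⟩ := hf.2 t
      have hK0 : 0 ≤ K := (abs_nonneg _).trans (hK t ht le_rfl)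
      have hb : ∀ s, ‖‖cut f s‖‖ ≤ K := by
        intro s
        rw [norm_norm]
        by_cases hs : s ∈ Ioc 0 t
        · rw [h1 f s hs.1 hs.2]
          exact hK s hs.1 hs.2
        · rw [show cut f s = 0 from indicator_of_notMem hs _, norm_zero]
          exact hK0
      exact Integrable.bdd_mul (h2.comp_sub_left t)
        (hint hf.locInt).aestronglyMeasurable.norm (Eventually.of_forall hb))
  rw [convolution_def, convolution_def] at hassoc
  refine Eq.trans ?_ (hassoc.trans ?_)
  · exact (integral_mul_sub_eq_halfConv ht.le (hc0 f g) (h0 k)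
      (fun r hr hrs => hc1 f g r hr hrs.le) (fun r hr hrs => h1 k r hr hrs.le)).symm
  · exact integral_mul_sub_eq_halfConv ht.le (h0 f) (hc0 g k)
      (fun r hr hrs => h1 f r hr hrs.le) (fun r hr hrs => hc1 g k r hr hrs.le)

lemma LocBdd.halfConv {f g : ℝ → ℝ} (hf : LocBdd f) (hg : LocInt g) : LocBdd (halfConv f g) := by
  have hbound : ∀ T s, 0 < s → s ≤ T → ∀ K, (∀ r, 0 < r → r ≤ T → |f r| ≤ K) →
      |_root_.halfConv f g s| ≤ K * ∫ r in Ioc 0 T, |g r| := by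
    intro T s hs hsT K hK
    have hK0 : 0 ≤ K := (abs_nonneg _).trans (hK s hs hsT)
    rw [halfConv_comm, _root_.halfConv, intervalIntegral.integral_of_le hs.le,
      integral_Ioc_eq_integral_Ioo]
    rw [← Real.norm_eq_abs]
    refine (norm_integral_le_integral_norm _).trans ?_
    have h1 : IntegrableOn (fun r => K * |g r|) (Ioc 0 T) := (hg.2 T).abs.const_mul K
    have hsub : Ioo 0 s ⊆ Ioc 0 T := fun r hr => ⟨hr.1, hr.2.le.trans hsT⟩
    rw [← integral_const_mul]
    refine le_trans ?_ (setIntegral_mono_set h1 (Eventually.of_forall fun r =>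
      mul_nonneg hK0 (abs_nonneg _)) hsub.eventuallyLE)
    refine integral_mono_of_nonneg (Eventually.of_forall fun r => norm_nonneg _)
      (h1.mono_set hsub) ((ae_restrict_iff' measurableSet_Ioo).2
        (Eventually.of_forall fun r hr => ?_))
    dsimp only
    rw [norm_mul, mul_comm]
    exact mul_le_mul_of_nonneg_right (hK _ (by linarith [hr.2]) (by linarith [hr.1]))
      (norm_nonneg _)
  refine ⟨?_, fun T => ?_⟩
  · intro t ht
    have ht : 0 < t := ht
    refine ContinuousAt.continuousWithinAt ?_
    have heq : ∀ s ∈ Ioo 0 (t + 1), _root_.halfConv f g s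
        = ∫ r in Ioc 0 (t + 1), g r * (Ioi 0).indicator f (s - r) := by
      intro s hs
      rw [halfConv_comm, ← integral_indicator measurableSet_Ioc]
      rw [← integral_mul_sub_eq_halfConv (φ := (Ioc 0 (t + 1)).indicator g)
        (ψ := (Ioi 0).indicator f) hs.1.le]
      · refine integral_congr_ae (Eventually.of_forall fun r => ?_)
        simp only [indicator]
        split_ifs <;> simp
      · exact fun r hr => indicator_of_notMem (fun h => absurd h.1 (not_lt.2 hr)) _
      · exact fun r hr => indicator_of_notMem (fun h => absurd h (not_lt.2 hr)) _
      · exact fun r hr hrs => indicator_of_mem (mem_Ioc.2 ⟨hr, hrs.le.trans hs.2.le⟩) _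
      · exact fun r hr _ => indicator_of_mem (mem_Ioi.2 hr) _
    obtain ⟨K, hK⟩ := hf.2 (t + 1)
    have hK0 : 0 ≤ K := (abs_nonneg _).trans (hK t ht (by linarith))
    have hnhds : Ioo 0 (t + 1) ∈ 𝓝 t := Ioo_mem_nhds ht (by linarith)
    have hlim : ContinuousAt
        (fun s => ∫ r in Ioc 0 (t + 1), g r * (Ioi 0).indicator f (s - r)) t := by
      refine continuousAt_of_dominated (bound := fun r => |g r| * K) ?_ ?_ ?_ ?_
      · refine Eventually.of_forall fun s => (hg.2 _).aestronglyMeasurable.mul ?_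
        have h1 : Measurable ((Ioi (0 : ℝ)).indicator f) := by
          rw [← piecewise_eq_indicator]
          exact hf.1.measurable_piecewise (g := 0) continuousOn_const measurableSet_Ioi
        exact (h1.comp (measurable_const.sub measurable_id)).aestronglyMeasurable
      · filter_upwards [hnhds] with s hs
        refine (ae_restrict_iff' measurableSet_Ioc).2 (Eventually.of_forall fun r hr => ?_)
        rw [norm_mul]
        refine mul_le_mul_of_nonneg_left ?_ (norm_nonneg _)
        by_cases h : s - r ∈ Ioi 0
        · rw [indicator_of_mem h]
          exact hK _ h (by linarith [hs.2, hr.1])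
        · rw [indicator_of_notMem h, norm_zero]
          exact hK0
      · exact (hg.2 _).abs.mul_const K
      · have hne : ∀ᵐ r : ℝ, r ≠ t := by simp [ae_iff]
        refine ae_restrict_of_ae (hne.mono fun r hr => ?_)
        refine continuousAt_const.mul ?_
        rcases lt_or_gt_of_ne hr with h | h
        · have h1 : (fun s => (Ioi 0).indicator f (s - r)) =ᶠ[𝓝 t] fun s => f (s - r) := by
            filter_upwards [Ioi_mem_nhds h] with s hs
            exact indicator_of_mem (sub_pos.2 hs) _
          refine ContinuousAt.congr ?_ h1.symm
          exact ContinuousAt.comp (g := f) (f := fun s => s - r)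
            (hf.1.continuousAt (Ioi_mem_nhds (sub_pos.2 h))) (by fun_prop)
        · have h1 : (fun s => (Ioi 0).indicator f (s - r)) =ᶠ[𝓝 t] fun s => 0 := by
            filter_upwards [Iio_mem_nhds h] with s hs
            exact indicator_of_notMem (fun h' => absurd (sub_pos.1 h') (not_lt.2 (le_of_lt hs))) _
          exact continuousAt_const.congr h1.symm
    exact hlim.congr (eventually_of_mem hnhds fun s hs => (heq s hs).symm)
  · obtain ⟨K, hK⟩ := hf.2 T
    exact ⟨_, fun s hs hsT => hbound T s hs hsT K hK⟩

lemma LocInt.hasDerivAt_integral {f : ℝ → ℝ} (hf : LocInt f) {t : ℝ} (ht : 0 < t) :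
    HasDerivAt (fun u => ∫ s in (0 : ℝ)..u, f s) (f t) t :=
  intervalIntegral.integral_hasDerivAt_right (hf.intervalIntegrable ht.le)
    (hf.1.stronglyMeasurableAtFilter isOpen_Ioi t ht) (hf.1.continuousAt (Ioi_mem_nhds ht))

lemma LocInt.tendsto_integral {f : ℝ → ℝ} (hf : LocInt f) :
    Tendsto (fun u => ∫ s in (0 : ℝ)..u, f s) (𝓝[>] 0) (𝓝 0) := by
  have h1 := intervalIntegral.continuousOn_primitive_interval (μ := volume) (a := 0) (b := 1)
    (f := f) (by
      rw [uIcc_of_le zero_le_one]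
      exact (integrableOn_Icc_iff_integrableOn_Ioc).2 (hf.2 1))
  have h2 := h1 0 left_mem_uIcc
  rw [uIcc_of_le zero_le_one, ContinuousWithinAt, intervalIntegral.integral_same] at h2
  have h3 : 𝓝[>] (0 : ℝ) ≤ 𝓝[Icc 0 1] 0 := by
    rw [← nhdsWithin_Ioc_eq_nhdsGT zero_lt_one]
    exact nhdsWithin_mono _ Ioc_subset_Icc_self
  exact h2.mono_left h3

/-- A function of the form `b + ∫₀ᵗ f` on `(0,∞)` determines `b` and `f`. -/
lemma LocInt.primitive_unique {f f' : ℝ → ℝ} {b b' : ℝ} (hf : LocInt f) (hf' : LocInt f')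
    (h : ∀ t, 0 < t → b + ∫ s in (0 : ℝ)..t, f s = b' + ∫ s in (0 : ℝ)..t, f' s) :
    b = b' ∧ ∀ t, 0 < t → f t = f' t := by
  refine ⟨?_, fun t ht => ?_⟩
  · have h1 := hf.tendsto_integral.const_add b
    have h2 := hf'.tendsto_integral.const_add b'
    rw [add_zero] at h1 h2
    refine tendsto_nhds_unique h1 (h2.congr' ?_)
    filter_upwards [self_mem_nhdsWithin] with t ht using (h t ht).symm
  · refine ((hf.hasDerivAt_integral ht).const_add b).unique
      (((hf'.hasDerivAt_integral ht).const_add b').congr_of_eventuallyEq ?_)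
    filter_upwards [Ioi_mem_nhds ht] with s hs using h s hs

lemma LocInt.eq_zero_of_integral {f : ℝ → ℝ} (hf : LocInt f)
    (h : ∀ t, 0 < t → ∫ s in (0 : ℝ)..t, f s = 0) {t : ℝ} (ht : 0 < t) : f t = 0 :=
  (LocInt.primitive_unique (b := 0) (b' := 0) (f' := fun _ => 0) hf
    (LocBdd.of_continuous continuous_const).locInt (fun t ht => by simp [h t ht])).2 t ht

lemma halfConv_one (f : ℝ → ℝ) (t : ℝ) : halfConv f (fun _ => 1) t = ∫ s in (0 : ℝ)..t, f s := by
  simp [halfConv]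

lemma halfConv_eq_zero_of_primitive {f g d : ℝ → ℝ} (hg : LocBdd g) (hd : LocInt d)
    (hfg : ∀ t, 0 < t → f t = ∫ s in (0 : ℝ)..t, g s) (h : ∀ t, 0 < t → halfConv f d t = 0) {t : ℝ}
    (ht : 0 < t) : halfConv g d t = 0 := by
  have hone : LocBdd fun _ => (1 : ℝ) := LocBdd.of_continuous continuous_const
  refine (hg.halfConv hd).locInt.eq_zero_of_integral (fun t ht => ?_) ht
  rw [← halfConv_one, halfConv_comm, ← halfConv_assoc hone hg.locInt hd ht, ← h t ht]
  refine halfConv_congr ht.le (fun s hs => ?_) fun _ _ => rfl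
  rw [halfConv_comm, halfConv_one, hfg s hs]

lemma eq_zero_of_halfConv_sq_eq_zero {d : ℝ → ℝ} (hd : LocInt d)
    (h : ∀ t, 0 < t → halfConv (fun s => s ^ 2 / 2) d t = 0) {t : ℝ} (ht : 0 < t) : d t = 0 := by
  have h1 : ∀ t, 0 < t → halfConv (fun s => s) d t = 0 := fun t ht =>
    halfConv_eq_zero_of_primitive (LocBdd.of_continuous continuous_id) hd
      (fun t _ => by simp) h ht
  have h2 : ∀ t, 0 < t → halfConv (fun _ => 1) d t = 0 := fun t ht =>
    halfConv_eq_zero_of_primitive (LocBdd.of_continuous continuous_const) hd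
      (fun t _ => by simp) h1 ht
  refine hd.eq_zero_of_integral (fun t ht => ?_) ht
  rw [← halfConv_one, halfConv_comm, h2 t ht]

lemma LocBdd.primitive {f : ℝ → ℝ} (hf : LocInt f) (b : ℝ) :
    LocBdd fun t => b + ∫ s in (0 : ℝ)..t, f s := by
  have := (LocBdd.of_continuous (f := fun _ => (1 : ℝ)) continuous_const).halfConv hf
  have heq : _root_.halfConv (fun _ => 1) f = fun t => ∫ s in (0 : ℝ)..t, f s :=
    funext fun t => by rw [halfConv_comm, halfConv_one]
  rw [heq] at this
  exact (LocBdd.of_continuous continuous_const).add this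

lemma halfConv_primitive {a f : ℝ → ℝ} (ha : LocBdd a) (hf : LocInt f) (b : ℝ) {t : ℝ}
    (ht : 0 < t) : halfConv a (fun t => b + ∫ s in (0 : ℝ)..t, f s) t
      = ∫ s in (0 : ℝ)..t, (a s * b + halfConv a f s) := by
  have hone : LocBdd fun _ => (1 : ℝ) := LocBdd.of_continuous continuous_const
  have hprim := LocBdd.primitive hf 0
  simp only [zero_add] at hprim
  rw [intervalIntegral.integral_add ((ha.locInt.intervalIntegrable ht.le).mul_const b)
    ((ha.halfConv hf).locInt.intervalIntegrable ht.le), ← halfConv_one (halfConv a f),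
    halfConv_assoc ha hf hone.locInt ht]
  simp only [halfConv, mul_add]
  have hconst : IntervalIntegrable (fun s => a s * b) volume 0 t :=
    (ha.locInt.intervalIntegrable ht.le).mul_const b
  rw [intervalIntegral.integral_add hconst (halfConv_intervalIntegrable ha hprim.locInt ht.le)]
  simp

lemma exists_eq_add_integral {q g : ℝ → ℝ} (hq : ∀ t, 0 < t → 0 ≤ q t)
    (hd : ∀ t, 0 < t → HasDerivAt q (g t) t) (hg : ContinuousOn g (Ioi 0))
    (hg0 : ∀ t, 0 < t → 0 ≤ g t) :
    ∃ b, LocInt g ∧ ∀ t, 0 < t → q t = b + ∫ s in (0 : ℝ)..t, g s := by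
  have hmono : MonotoneOn q (Ioi 0) := by
    refine monotoneOn_of_deriv_nonneg (convex_Ioi 0)
      (fun t ht => (hd t ht).continuousAt.continuousWithinAt) ?_ ?_
    · intro t ht
      rw [interior_Ioi] at ht
      exact (hd t ht).differentiableAt.differentiableWithinAt
    · intro t ht
      rw [interior_Ioi] at ht
      rw [(hd t ht).deriv]
      exact hg0 t ht
  have hlim := hmono.tendsto_nhdsGT ⟨0, by rintro _ ⟨t, ht, rfl⟩; exact hq t ht⟩
  set b := sInf (q '' Ioi 0)
  have hint : ∀ T, IntegrableOn g (Ioc 0 T) := by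
    intro T
    rcases le_or_gt T 0 with hT | hT
    · simp [Ioc_eq_empty (not_lt.2 hT)]
    refine intervalIntegral.integrableOn_deriv_of_nonneg (g := Function.update q 0 b) ?_
      (fun t ht => ?_) fun t ht => hg0 t ht.1
    · intro t ht
      rcases ht.1.eq_or_lt with rfl | h
      · rw [continuousWithinAt_update_same]
        exact hlim.mono_left (nhdsWithin_mono _ fun s hs =>
          lt_of_le_of_ne hs.1.1 (Ne.symm hs.2))
      · refine ContinuousAt.continuousWithinAt ?_
        rw [continuousAt_update_of_ne h.ne']
        exact (hd t h).continuousAt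
    · refine (hd t ht.1).congr_of_eventuallyEq ?_
      filter_upwards [Ioi_mem_nhds ht.1] with s hs
      exact Function.update_of_ne (ne_of_gt hs) _ _
  refine ⟨b, ⟨hg, hint⟩, fun t ht => ?_⟩
  rw [intervalIntegral.integral_eq_sub_of_hasDerivAt_of_tendsto ht (fun s hs => hd s hs.1)
    ((intervalIntegrable_iff_integrableOn_Ioc_of_le ht.le).2 (hint t)) hlim
    ((hd t ht).continuousAt.tendsto.mono_left nhdsWithin_le_nhds)]
  ring

section Bernstein

variable {m : ℕ}

lemma apply_eq_quadForm_polarization {M : Matrix (Fin m) (Fin m) ℝ} (hM : Mᵀ = M) (i j : Fin m) :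
    M i j = (quadForm (Pi.single i 1 + Pi.single j 1) M
      - quadForm (Pi.single i 1 - Pi.single j 1) M) / 4 := by
  have h : M j i = M i j := congrFun (congrFun hM i) j
  simp [quadForm_apply, mulVec_add, mulVec_sub, h]
  ring

lemma MatBernstein.exists_conv_solution {A : ℝ → Matrix (Fin m) (Fin m) ℝ} (hA : MatBernstein m A)
    (hpsd : ∀ t ∈ Ioi (0 : ℝ), (A t).PosSemidef)
    (hnz : ∀ v : Fin m → ℝ, v ≠ 0 → ∃ t ∈ Ioi (0 : ℝ), v ⬝ᵥ (A t).mulVec v ≠ 0) :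
    ∃ (B : Matrix (Fin m) (Fin m) ℝ) (F Y : ℝ → Matrix (Fin m) (Fin m) ℝ),
      B.PosSemidef ∧ MatLICM m F ∧ (∀ t, 0 < t → (F t).PosSemidef) ∧
      (∀ i j, LocInt fun t => F t i j) ∧ (∀ t, 0 < t → (Y t).PosSemidef) ∧
      (∀ t, 0 < t → ∀ i j, Y t i j = B i j + ∫ s in (0 : ℝ)..t, F s i j) ∧
      ∀ t, 0 < t → ∀ i j, ∑ l, halfConv (fun s => A s i l) (fun s => Y s l j) t
        = ((t ^ 2 / 2) • (1 : Matrix (Fin m) (Fin m) ℝ)) i j := by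
  obtain ⟨Y, hY, hYg, hconv⟩ := hA.exists_primitive_solution hpsd hnz
  choose g hg hgd using hYg
  have hsymm : ∀ t, 0 < t → (Y t)ᵀ = Y t := fun t ht => (posSemidef_iff_quadForm.1 (hY t ht)).1
  choose b hgint hb using fun v => exists_eq_add_integral
    (fun t ht => (posSemidef_iff_quadForm.1 (hY t ht)).2 v) (hgd v) (hg v).contDiffOn.continuousOn
    (fun t ht => (hg v).nonneg ht)
  set u : Fin m → Fin m → Fin m → ℝ := fun i j => Pi.single i 1 + Pi.single j 1
  set w : Fin m → Fin m → Fin m → ℝ := fun i j => Pi.single i 1 - Pi.single j 1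
  have hYd : ∀ i j t, 0 < t → HasDerivAt (fun s => Y s i j)
      ((g (u i j) t - g (w i j) t) / 4) t := by
    intro i j t ht
    refine (((hgd (u i j) t ht).sub (hgd (w i j) t ht)).div_const 4).congr_of_eventuallyEq ?_
    filter_upwards [Ioi_mem_nhds ht] with s hs
    exact apply_eq_quadForm_polarization (hsymm s hs) i j
  have hF : ∀ i j t, 0 < t → matDeriv m Y t i j = (g (u i j) t - g (w i j) t) / 4 :=
    fun i j t ht => (hYd i j t ht).deriv
  have hquad : ∀ v t, 0 < t → quadForm v (matDeriv m Y t) = g v t := fun v t ht =>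
    (hasDerivAt_quadForm (fun i j t ht => (hYd i j t ht).differentiableAt.differentiableWithinAt)
      v ht).unique (hgd v t ht)
  have hFsymm : ∀ t, 0 < t → (matDeriv m Y t)ᵀ = matDeriv m Y t := by
    intro t ht
    ext i j
    refine Filter.EventuallyEq.deriv_eq ?_
    filter_upwards [Ioi_mem_nhds ht] with s hs
    exact congrFun (congrFun (hsymm s hs) i) j
  have hFint : ∀ i j, LocInt fun t => matDeriv m Y t i j := by
    intro i j
    refine ⟨?_, fun T => ?_⟩
    · refine ContinuousOn.congr ?_ fun t ht => hF i j t ht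
      exact ((hgint _).1.sub (hgint _).1).div_const 4
    · refine IntegrableOn.congr_fun ?_ (fun t ht => (hF i j t ht.1).symm) measurableSet_Ioc
      exact (((hgint _).2 T).sub ((hgint _).2 T)).div_const 4
  set B : Matrix (Fin m) (Fin m) ℝ := Matrix.of fun i j => (b (u i j) - b (w i j)) / 4 with hB
  have hYB : ∀ t, 0 < t → ∀ i j, Y t i j = B i j + ∫ s in (0 : ℝ)..t, matDeriv m Y s i j := by
    intro t ht i j
    have h1 : ∫ s in (0 : ℝ)..t, matDeriv m Y s i j
        = ∫ s in (0 : ℝ)..t, (g (u i j) s - g (w i j) s) / 4 := by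
      rw [intervalIntegral.integral_of_le ht.le, intervalIntegral.integral_of_le ht.le]
      exact setIntegral_congr_fun measurableSet_Ioc fun s hs => hF i j s hs.1
    have h2 : Y t i j = (quadForm (u i j) (Y t) - quadForm (w i j) (Y t)) / 4 :=
      apply_eq_quadForm_polarization (hsymm t ht) i j
    rw [h1, h2, hb (u i j) t ht, hb (w i j) t ht, intervalIntegral.integral_div,
      intervalIntegral.integral_sub ((hgint _).intervalIntegrable ht.le)
      ((hgint _).intervalIntegrable ht.le)]
    simp only [hB, of_apply]
    ring
  refine ⟨B, matDeriv m Y, Y, ?_, ⟨⟨fun i j => ?_, fun v n t ht => ?_⟩, fun i j => (hFint i j).2 1⟩,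
    fun t ht => posSemidef_iff_quadForm.2 ⟨hFsymm t ht, fun v => ?_⟩, hFint, hY, hYB, hconv⟩
  · change B ∈ {M : Matrix (Fin m) (Fin m) ℝ | M.PosSemidef}
    refine isClosed_posSemidef.mem_of_tendsto (f := Y) (b := 𝓝[>] (0 : ℝ))
      (tendsto_matrix fun i j => ?_) ?_
    · have := (hFint i j).tendsto_integral.const_add (B i j)
      rw [add_zero] at this
      refine this.congr' ?_
      filter_upwards [self_mem_nhdsWithin] with t ht using (hYB t ht i j).symm
    · filter_upwards [self_mem_nhdsWithin] with t ht using hY t ht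
  · refine ContDiffOn.congr ?_ fun t ht => hF i j t ht
    exact ((hg _).contDiffOn.sub (hg _).contDiffOn).div_const 4
  · have : (fun s => v ⬝ᵥ (matDeriv m Y s).mulVec v) =ᶠ[𝓝 t] g v := by
      filter_upwards [Ioi_mem_nhds ht] with s hs using hquad v s hs
    rw [this.iteratedDeriv_eq]
    exact (hg v).iteratedDeriv_nonneg n ht
  · rw [hquad v t ht]
    exact (hg v).nonneg ht

lemma MatLICM.locInt {F : ℝ → Matrix (Fin m) (Fin m) ℝ} (hF : MatLICM m F) (i j : Fin m) :
    LocInt fun t => F t i j := by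
  have hc : ContinuousOn (fun t => F t i j) (Ioi 0) := (hF.1.1 i j).continuousOn
  refine ⟨hc, fun T => ?_⟩
  have h1 : IntegrableOn (fun t => F t i j) (Icc 1 T) :=
    (hc.mono fun t ht => zero_lt_one.trans_le ht.1).integrableOn_Icc
  refine ((hF.2 i j).union h1).mono_set fun t ht => ?_
  rcases le_total t 1 with h | h
  · exact Or.inl ⟨ht.1, h⟩
  · exact Or.inr ⟨h, ht.2⟩

lemma MatBernstein.locBdd {A : ℝ → Matrix (Fin m) (Fin m) ℝ} (hA : MatBernstein m A)
    (hpsd : ∀ t ∈ Ioi (0 : ℝ), (A t).PosSemidef) (i j : Fin m) : LocBdd fun t => A t i j :=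
  ⟨hA.continuousOn_apply i j, fun T =>
    ⟨(A T).trace, fun _ hs hsT => hA.abs_apply_le hpsd hs hsT i j⟩⟩

lemma matConv_apply_eq_sum_halfConv {A F : ℝ → Matrix (Fin m) (Fin m) ℝ}
    (hA : ∀ i j, LocBdd fun t => A t i j) (hF : ∀ i j, LocInt fun t => F t i j) {t : ℝ}
    (ht : 0 < t) (i j : Fin m) :
    matConv m A F t i j = ∑ l, halfConv (fun s => A s i l) (fun s => F s l j) t :=
  intervalIntegral.integral_finsetSum fun l _ => halfConv_intervalIntegrable (hA i l) (hF l j) ht.le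

lemma sum_halfConv_primitive {A F : ℝ → Matrix (Fin m) (Fin m) ℝ} (B : Matrix (Fin m) (Fin m) ℝ)
    (hA : ∀ i j, LocBdd fun t => A t i j) (hF : ∀ i j, LocInt fun t => F t i j) {t : ℝ}
    (ht : 0 < t) (i j : Fin m) :
    ∑ l, halfConv (fun s => A s i l) (fun t => B l j + ∫ s in (0 : ℝ)..t, F s l j) t
      = ∫ s in (0 : ℝ)..t, (A s * B + matConv m A F s) i j := by
  have h1 : ∀ l, IntervalIntegrable
      (fun s => A s i l * B l j + halfConv (fun s => A s i l) (fun s => F s l j) s) volume 0 t :=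
    fun l => (((hA i l).locInt.intervalIntegrable ht.le).mul_const _).add
      (((hA i l).halfConv (hF l j)).locInt.intervalIntegrable ht.le)
  rw [Finset.sum_congr rfl fun l _ => halfConv_primitive (hA i l) (hF l j) (B l j) ht,
    ← intervalIntegral.integral_finsetSum fun l _ => h1 l, intervalIntegral.integral_of_le ht.le,
    intervalIntegral.integral_of_le ht.le]
  refine setIntegral_congr_fun measurableSet_Ioc fun s hs => ?_
  simp only [Matrix.add_apply, Matrix.mul_apply, matConv_apply_eq_sum_halfConv hA hF hs.1,
    Finset.sum_add_distrib]

/-- Integrating the convolution equation: `X = B·δ + F` solves `A ∗ X = t·I` if and only if its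
primitive `Y(t) = B + ∫₀ᵗ F` solves `A ∗ Y = (t²/2)·I`. -/
lemma conv_eq_iff_conv_primitive_eq {A F : ℝ → Matrix (Fin m) (Fin m) ℝ}
    (B : Matrix (Fin m) (Fin m) ℝ) (hA : ∀ i j, LocBdd fun t => A t i j)
    (hF : ∀ i j, LocInt fun t => F t i j) :
    (∀ t, 0 < t → A t * B + matConv m A F t = t • (1 : Matrix (Fin m) (Fin m) ℝ)) ↔
      ∀ t, 0 < t → ∀ i j,
        ∑ l, halfConv (fun s => A s i l) (fun t => B l j + ∫ s in (0 : ℝ)..t, F s l j) t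
          = ((t ^ 2 / 2) • (1 : Matrix (Fin m) (Fin m) ℝ)) i j := by
  have hright : ∀ (t : ℝ) i j, ((t ^ 2 / 2) • (1 : Matrix (Fin m) (Fin m) ℝ)) i j
      = 0 + ∫ s in (0 : ℝ)..t, (s • (1 : Matrix (Fin m) (Fin m) ℝ)) i j := by
    intro t i j
    simp
  have hsmul : ∀ i j, LocInt fun t : ℝ => (t • (1 : Matrix (Fin m) (Fin m) ℝ)) i j := fun i j =>
    (LocBdd.of_continuous (by simp only [Matrix.smul_apply, smul_eq_mul]; fun_prop)).locInt
  have hleft : ∀ i j, LocInt fun t => (A t * B + matConv m A F t) i j := by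
    intro i j
    have h : LocBdd fun t => ∑ l, (A t i l * B l j
        + halfConv (fun s => A s i l) (fun s => F s l j) t) :=
      LocBdd.sum fun l _ => ((hA i l).mul (LocBdd.of_continuous continuous_const)).add
        ((hA i l).halfConv (hF l j))
    have heq : ∀ t, 0 < t → (A t * B + matConv m A F t) i j = ∑ l, (A t i l * B l j
        + halfConv (fun s => A s i l) (fun s => F s l j) t) := fun t ht => by
      simp only [Matrix.add_apply, Matrix.mul_apply, matConv_apply_eq_sum_halfConv hA hF ht,
        Finset.sum_add_distrib]
    exact ⟨h.1.congr fun t ht => heq t ht, fun T => (h.locInt.2 T).congr_fun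
      (fun t ht => (heq t ht.1).symm) measurableSet_Ioc⟩
  constructor
  · intro h t ht i j
    rw [sum_halfConv_primitive B hA hF ht, hright, zero_add, intervalIntegral.integral_of_le ht.le,
      intervalIntegral.integral_of_le ht.le]
    exact setIntegral_congr_fun measurableSet_Ioc fun s hs => by simp only [h s hs.1]
  · intro h t ht
    ext i j
    refine ((hleft i j).primitive_unique (hsmul i j) (b := 0) (b' := 0) fun t ht => ?_).2 t ht
    rw [← hright, ← h t ht i j, sum_halfConv_primitive B hA hF ht, zero_add]

/-- If `Z ∗ A = A ∗ Y = (t²/2)·I`, then `Z = Y`, by associativity of the convolution. -/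
lemma eq_of_conv_eq_of_conv_eq {A Y Z : ℝ → Matrix (Fin m) (Fin m) ℝ}
    (hA : ∀ i j, LocBdd fun t => A t i j) (hY : ∀ i j, LocBdd fun t => Y t i j)
    (hZ : ∀ i j, LocBdd fun t => Z t i j)
    (hZA : ∀ t, 0 < t → ∀ i j, ∑ l, halfConv (fun s => Z s i l) (fun s => A s l j) t
      = ((t ^ 2 / 2) • (1 : Matrix (Fin m) (Fin m) ℝ)) i j)
    (hAY : ∀ t, 0 < t → ∀ i j, ∑ l, halfConv (fun s => A s i l) (fun s => Y s l j) t
      = ((t ^ 2 / 2) • (1 : Matrix (Fin m) (Fin m) ℝ)) i j)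
    {t : ℝ} (ht : 0 < t) : Z t = Y t := by
  have hdelta : ∀ (f : Fin m → ℝ → ℝ) i t, 0 < t →
      ∑ l, halfConv (fun s => ((s ^ 2 / 2) • (1 : Matrix (Fin m) (Fin m) ℝ)) i l) (f l) t
        = halfConv (fun s => s ^ 2 / 2) (f i) t := by
    intro f i t ht
    rw [Finset.sum_eq_single i]
    · simp
    · intro l _ hl
      simp [Matrix.one_apply_ne hl.symm, halfConv]
    · simp
  have key : ∀ i j t, 0 < t → halfConv (fun s => s ^ 2 / 2) (fun s => Y s i j) t
      = halfConv (fun s => s ^ 2 / 2) (fun s => Z s i j) t := by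
    intro i j t ht
    have h1 := hdelta (fun l s => Y s l j) i t ht
    have h2 := hdelta (fun l s => Z s i l) j t ht
    rw [← h1, ← h2]
    have e1 : ∀ l, halfConv (fun s => ((s ^ 2 / 2) • (1 : Matrix (Fin m) (Fin m) ℝ)) i l)
        (fun s => Y s l j) t
        = ∑ k, halfConv (halfConv (fun s => Z s i k) (fun s => A s k l)) (fun s => Y s l j) t := by
      intro l
      rw [← halfConv_sum_left (fun k _ => (hZ i k).halfConv (hA k l).locInt) (hY l j).locInt ht.le]
      exact halfConv_congr ht.le (fun s hs => (hZA s hs i l).symm) fun _ _ => rfl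
    have e2 : ∀ k, halfConv (fun s => ((s ^ 2 / 2) • (1 : Matrix (Fin m) (Fin m) ℝ)) j k)
        (fun s => Z s i k) t
        = ∑ l, halfConv (fun s => Z s i k) (halfConv (fun s => A s k l) (fun s => Y s l j)) t := by
      intro k
      rw [halfConv_comm, ← halfConv_sum_right (fun l _ => (hA k l).halfConv (hY l j).locInt)
        (hZ i k).locInt ht.le]
      refine halfConv_congr ht.le (fun _ _ => rfl) fun s hs => ?_
      rw [hAY s hs k j]
      simp [Matrix.one_apply, eq_comm]
    rw [Finset.sum_congr rfl fun l _ => e1 l, Finset.sum_congr rfl fun k _ => e2 k,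
      Finset.sum_comm]
    exact Finset.sum_congr rfl fun k _ => Finset.sum_congr rfl fun l _ =>
      halfConv_assoc (hZ i k) (hA k l).locInt (hY l j).locInt ht
  ext i j
  have hneg : LocBdd fun t => -1 * Z t i j := (LocBdd.of_continuous continuous_const).mul (hZ i j)
  have hd := (hY i j).add hneg
  have hp : LocBdd fun s => s ^ 2 / 2 := LocBdd.of_continuous (by fun_prop)
  have := eq_zero_of_halfConv_sq_eq_zero hd.locInt (fun t ht => ?_) ht
  · linarith
  · have h1 := halfConv_intervalIntegrable hp (hY i j).locInt ht.le
    have h2 := halfConv_intervalIntegrable hp (hZ i j).locInt ht.le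
    have h3 := key i j t ht
    simp only [halfConv] at h3 ⊢
    rw [← sub_eq_zero, ← intervalIntegral.integral_sub h1 h2] at h3
    rw [← h3]
    congr 1
    funext s
    ring

end Bernstein

/-- If `A : (0,∞) → S₊` is an `S₊`-valued Bernstein function such that for
each nonzero `v` the function `t ↦ vᵀ A(t) v` is not identically zero, then there exist
`B ∈ S₊` and an `S₊`-valued LICM function `F` such that `X(t) = B·δ(t) + F(t)` solves
`(A∗X)(t) = t·I`, i.e. `A(t)·B + (A∗F)(t) = t·I` for all `t > 0`; moreover this solution
is unique. -/
theorem conv_eq_tI_unique_solution_of_bernstein (m : ℕ) (A : ℝ → Matrix (Fin m) (Fin m) ℝ)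
    (hBF : MatBernstein m A)
    (hpsd : ∀ t ∈ Set.Ioi (0:ℝ), (A t).PosSemidef)
    (hnz : ∀ v : Fin m → ℝ, v ≠ 0 → ∃ t ∈ Set.Ioi (0:ℝ), v ⬝ᵥ (A t).mulVec v ≠ 0) :
    ∃ (B : Matrix (Fin m) (Fin m) ℝ) (F : ℝ → Matrix (Fin m) (Fin m) ℝ),
      B.PosSemidef ∧ MatLICM m F ∧ (∀ t ∈ Set.Ioi (0:ℝ), (F t).PosSemidef) ∧
      (∀ t ∈ Set.Ioi (0:ℝ),
        A t * B + matConv m A F t = t • (1 : Matrix (Fin m) (Fin m) ℝ)) ∧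
      ∀ (B' : Matrix (Fin m) (Fin m) ℝ) (F' : ℝ → Matrix (Fin m) (Fin m) ℝ),
        B'.PosSemidef → MatLICM m F' → (∀ t ∈ Set.Ioi (0:ℝ), (F' t).PosSemidef) →
        (∀ t ∈ Set.Ioi (0:ℝ),
          A t * B' + matConv m A F' t = t • (1 : Matrix (Fin m) (Fin m) ℝ)) →
        B' = B ∧ ∀ t ∈ Set.Ioi (0:ℝ), F' t = F t := by
  obtain ⟨B, F, Y, hB, hF, hFpsd, hFint, hY, hYB, hconv⟩ := hBF.exists_conv_solution hpsd hnz
  have hA := hBF.locBdd hpsd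
  have hsymm : ∀ M : Matrix (Fin m) (Fin m) ℝ, M.PosSemidef → ∀ i j, M i j = M j i :=
    fun M hM i j => congrFun (congrFun (posSemidef_iff_quadForm.1 hM).1 j) i
  have hprim : ∀ t, 0 < t → ∀ i j,
      ∑ l, halfConv (fun s => A s i l) (fun t => B l j + ∫ s in (0 : ℝ)..t, F s l j) t
        = ((t ^ 2 / 2) • (1 : Matrix (Fin m) (Fin m) ℝ)) i j := by
    intro t ht i j
    rw [← hconv t ht i j]
    exact Finset.sum_congr rfl fun l _ =>
      halfConv_congr ht.le (fun _ _ => rfl) fun s hs => (hYB s hs l j).symm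
  refine ⟨B, F, hB, hF, hFpsd, (conv_eq_iff_conv_primitive_eq B hA hFint).2 hprim, ?_⟩
  intro B' F' _ hF' _ h'
  have hprim' := (conv_eq_iff_conv_primitive_eq B' hA hF'.locInt).1 h'
  have heq : ∀ t, 0 < t → (Matrix.of fun i j => B i j + ∫ s in (0 : ℝ)..t, F s i j)
      = Matrix.of fun i j => B' i j + ∫ s in (0 : ℝ)..t, F' s i j := by
    intro t ht
    refine eq_of_conv_eq_of_conv_eq
      (Z := fun t => Matrix.of fun i j => B i j + ∫ s in (0 : ℝ)..t, F s i j)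
      (Y := fun t => Matrix.of fun i j => B' i j + ∫ s in (0 : ℝ)..t, F' s i j)
      hA (fun i j => LocBdd.primitive (hF'.locInt i j) _)
      (fun i j => LocBdd.primitive (hFint i j) _) (fun t ht i j => ?_) hprim' ht
    rw [show ((t ^ 2 / 2) • (1 : Matrix (Fin m) (Fin m) ℝ)) i j
      = ((t ^ 2 / 2) • (1 : Matrix (Fin m) (Fin m) ℝ)) j i by simp [Matrix.one_apply, eq_comm],
      ← hconv t ht j i]
    refine Finset.sum_congr rfl fun l _ => ?_
    rw [halfConv_comm]
    refine halfConv_congr ht.le (fun s hs => hsymm _ (hpsd s hs) l j) fun s hs => ?_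
    rw [hsymm _ (hY s hs) l i, hYB s hs i l]
    rfl
  have hentry := fun i j => (hF'.locInt i j).primitive_unique (hFint i j) (b := B' i j)
    (b' := B i j) fun t ht => (congrFun (congrFun (heq t ht) i) j).symm
  exact ⟨Matrix.ext fun i j => (hentry i j).1,
    fun t ht => Matrix.ext fun i j => (hentry i j).2 t ht⟩
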